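/- arXiv:1601.01103 — 2 statements merged into one kernel-verified Lean document; each statement's English description precedes it below -/
import Mathlib

section
/- Let R be an Archimedean chain ring with maximal ideal P and let G be an almost FP-injective R-module. Then w.d.(G) ≤ 2. Moreover: (1) w.d.(G) = 0 if R is an IF-ring; (2) w.d.(G) ≤ 1 if R is a valuation domain; (3) if R is not coherent, then either w.d.(G) = 2 or w.d.(G) = 0, and more precisely G is flat if and only if for every 0 ≠ x ∈ G the annihilator (0:x) is not of the form Ra for some 0 ≠ a ∈ P; furthermore P ⊗_R G is flat and almost FP-injective. -/
open CategoryTheory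

universe u

/-- A chain ring: the lattice of ideals is totally ordered by inclusion. -/
def IsChainRing (R : Type u) [CommRing R] : Prop :=
  ∀ I J : Ideal R, I ≤ J ∨ J ≤ I

/-- The set of zero-divisors of `R`. -/
def zeroDivisorsSet (R : Type u) [CommRing R] : Set R :=
  {r : R | ∃ s : R, s ≠ 0 ∧ r * s = 0}

/-- An `R`-module `E` is FP-injective if `Ext¹_R(F, E) = 0` for every finitely
presented `R`-module `F`. -/
def IsFPInjective (R : Type u) [CommRing R] (E : Type u) [AddCommGroup E] [Module R E] : Prop :=
  ∀ F : ModuleCat.{u} R, Module.FinitePresentation R F →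
    Limits.IsZero (((Ext R (ModuleCat.{u} R) 1).obj (Opposite.op F)).obj (ModuleCat.of R E))

/-- A submodule `D ≤ E` is pure if `0 → D ⊗ N → E ⊗ N` is exact for every module `N`,
i.e. the sequence `0 → D → E → E/D → 0` remains exact after tensoring with any module. -/
def IsPureSubmodule {R : Type u} [CommRing R] {E : Type u} [AddCommGroup E] [Module R E]
    (D : Submodule R E) : Prop :=
  ∀ (N : Type u) [AddCommGroup N] [Module R N],
    Function.Injective (LinearMap.rTensor N D.subtype)

/-- An `R`-module `G` is almost FP-injective if `G ≅ E/D` for some FP-injective module `E`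
and pure submodule `D` of `E`. -/
def IsAlmostFPInjective (R : Type u) [CommRing R] (G : Type u) [AddCommGroup G]
    [Module R G] : Prop :=
  ∃ (E : Type u) (_ : AddCommGroup E) (_ : Module R E) (D : Submodule R E),
    IsFPInjective R E ∧ IsPureSubmodule D ∧ Nonempty ((E ⧸ D) ≃ₗ[R] G)

/-- The weak dimension of a module, as an element of `ℕ∞`: the least `n` such that
`Tor_{n+1}(M, N) = 0` for all modules `N` (and `⊤ = ∞` if there is no such `n`). -/
noncomputable def weakDim (R : Type u) [CommRing R] (M : Type u) [AddCommGroup M]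
    [Module R M] : ℕ∞ :=
  sInf {n : ℕ∞ | ∃ k : ℕ, n = k ∧ ∀ N : ModuleCat.{u} R,
    Limits.IsZero (((Tor (ModuleCat.{u} R) (k + 1)).obj (ModuleCat.of R M)).obj N)}

/-- The projective dimension of a module, as an element of `ℕ∞`: the least `n` such that
`Ext^{n+1}(M, N) = 0` for all modules `N` (and `⊤ = ∞` if there is no such `n`). -/
noncomputable def projDim (R : Type u) [CommRing R] (M : Type u) [AddCommGroup M]
    [Module R M] : ℕ∞ :=
  sInf {n : ℕ∞ | ∃ k : ℕ, n = k ∧ ∀ N : ModuleCat.{u} R,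
    Limits.IsZero (((Ext R (ModuleCat.{u} R) (k + 1)).obj
      (Opposite.op (ModuleCat.of R M))).obj N)}

/-- An IF-ring: every injective module is flat. -/
def IsIFRing (R : Type u) [CommRing R] : Prop :=
  ∀ (M : Type u) [AddCommGroup M] [Module R M], Module.Injective R M → Module.Flat R M

/-- A semicoherent ring: `Hom_R(E, F)` embeds into a flat module for every pair of
injective modules `E`, `F`. -/
def IsSemicoherent (R : Type u) [CommRing R] : Prop :=
  ∀ (E F : Type u) [AddCommGroup E] [Module R E] [AddCommGroup F] [Module R F],
    Module.Injective R E → Module.Injective R F →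
      ∃ (W : Type u) (_ : AddCommGroup W) (_ : Module R W),
        Module.Flat R W ∧ ∃ f : (E →ₗ[R] F) →ₗ[R] W, Function.Injective f

/-- A coherent ring: every finitely generated ideal is finitely presented. -/
def IsCoherentRing (R : Type u) [CommRing R] : Prop :=
  ∀ I : Ideal R, I.FG → Module.FinitePresentation R I

/-- `i : M →ₗ[R] E` exhibits `E` as an injective hull of `M`: `E` is injective and
`i` is an essential embedding. -/
def IsInjectiveHull (R : Type u) [CommRing R] (M E : Type u) [AddCommGroup M] [Module R M]
    [AddCommGroup E] [Module R E] (i : M →ₗ[R] E) : Prop :=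
  Module.Injective R E ∧ Function.Injective i ∧
    ∀ K : Submodule R E, K ≠ ⊥ → K ⊓ LinearMap.range i ≠ ⊥

/-- The bottom prime ideal `M_♯` (as a set): elements killing some nonzero element of `M`. -/
def bottomSet (R : Type u) [CommRing R] (M : Type u) [AddCommGroup M] [Module R M] : Set R :=
  {s : R | ∃ x : M, x ≠ 0 ∧ s • x = 0}

/-- The top prime ideal `M^♯` (as a set): elements `s` with `sM ⊊ M`. -/
def topSet (R : Type u) [CommRing R] (M : Type u) [AddCommGroup M] [Module R M] : Set R :=
  {s : R | ¬ Function.Surjective fun x : M => s • x}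

section TorVanishing

variable {R : Type u} [CommRing R]

/-- `Tor R n A N = 0` for every module `N`. -/
def TorVanishes (R : Type u) [CommRing R] (n : ℕ) (A : Type u) [AddCommGroup A] [Module R A] :
    Prop :=
  ∀ N : ModuleCat.{u} R,
    Limits.IsZero (((Tor (ModuleCat.{u} R) n).obj (ModuleCat.of R A)).obj N)

/-- The homology of `A ⊗ P` computes `Tor`, for a projective resolution `P`. -/
lemma isZero_tor_iff (A : ModuleCat.{u} R) {N : ModuleCat.{u} R} (P : ProjectiveResolution N)
    (n : ℕ) :
    Limits.IsZero (((Tor (ModuleCat.{u} R) n).obj A).obj N) ↔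
      Limits.IsZero
        ((((MonoidalCategory.tensoringLeft (ModuleCat.{u} R)).obj A).mapHomologicalComplex
          (ComplexShape.down ℕ)).obj P.complex |>.homology n) :=
  (P.isoLeftDerivedObj ((MonoidalCategory.tensoringLeft (ModuleCat.{u} R)).obj A) n).isZero_iff

lemma isZero_tor_succ_iff_exact (A : ModuleCat.{u} R) {N : ModuleCat.{u} R}
    (P : ProjectiveResolution N) (n : ℕ) :
    Limits.IsZero (((Tor (ModuleCat.{u} R) (n + 1)).obj A).obj N) ↔
      Function.Exact (LinearMap.lTensor A (P.complex.d (n + 2) (n + 1)).hom)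
        (LinearMap.lTensor A (P.complex.d (n + 1) n).hom) := by
  rw [isZero_tor_iff A P, ← HomologicalComplex.exactAt_iff_isZero_homology,
    HomologicalComplex.exactAt_iff' _ (n + 2) (n + 1) n (by simp) (by simp),
    ShortComplex.ShortExact.moduleCat_exact_iff_function_exact]
  rfl

section LongExactSequence

variable {A B C : Type u} [AddCommGroup A] [AddCommGroup B] [AddCommGroup C]
  [Module R A] [Module R B] [Module R C]

/-- A short exact sequence stays short exact after tensoring with a complex of projectives. -/
lemma exists_shortExact_tensor_resolution {f : A →ₗ[R] B} {g : B →ₗ[R] C}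
    (hf : Function.Injective f) (hg : Function.Surjective g) (hfg : Function.Exact f g)
    {N : ModuleCat.{u} R} (P : ProjectiveResolution N) :
    ∃ S : ShortComplex (ChainComplex (ModuleCat.{u} R) ℕ), S.ShortExact ∧
      S.X₁ = (((MonoidalCategory.tensoringLeft (ModuleCat.{u} R)).obj
        (ModuleCat.of R A)).mapHomologicalComplex (ComplexShape.down ℕ)).obj P.complex ∧
      S.X₂ = (((MonoidalCategory.tensoringLeft (ModuleCat.{u} R)).obj
        (ModuleCat.of R B)).mapHomologicalComplex (ComplexShape.down ℕ)).obj P.complex ∧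
      S.X₃ = (((MonoidalCategory.tensoringLeft (ModuleCat.{u} R)).obj
        (ModuleCat.of R C)).mapHomologicalComplex (ComplexShape.down ℕ)).obj P.complex := by
  have hz : ModuleCat.ofHom f ≫ ModuleCat.ofHom g = 0 :=
    ModuleCat.hom_ext (LinearMap.ext fun x => hfg.apply_apply_eq_zero x)
  let T := MonoidalCategory.tensoringLeft (ModuleCat.{u} R)
  refine ⟨ShortComplex.mk
    ((NatTrans.mapHomologicalComplex (T.map (ModuleCat.ofHom f)) _).app P.complex)
    ((NatTrans.mapHomologicalComplex (T.map (ModuleCat.ofHom g)) _).app P.complex) ?_,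
    ?_, rfl, rfl, rfl⟩
  · ext i : 1
    change (T.map (ModuleCat.ofHom f)).app _ ≫ (T.map (ModuleCat.ofHom g)).app _ = 0
    rw [← NatTrans.comp_app, ← Functor.map_comp, hz, T.map_zero]
    rfl
  · refine HomologicalComplex.shortExact_of_degreewise_shortExact _ fun i => ?_
    have : Projective (P.complex.X i) := P.projective i
    have hP : Module.Projective R (P.complex.X i) :=
      (IsProjective.iff_projective _).2 this
    refine ModuleCat.shortComplex_shortExact _ ?_ ?_ ?_
    · exact rTensor_exact (P.complex.X i) hfg hg
    · exact Module.Flat.rTensor_preserves_injective_linearMap (M := P.complex.X i) f hf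
    · exact LinearMap.rTensor_surjective (P.complex.X i) hg

variable {f : A →ₗ[R] B} {g : B →ₗ[R] C} (hf : Function.Injective f)
    (hg : Function.Surjective g) (hfg : Function.Exact f g) {n : ℕ}

include hf hg hfg

lemma TorVanishes.of_exact_right (hB : TorVanishes R (n + 1) B) (hA : TorVanishes R n A) :
    TorVanishes R (n + 1) C := fun N => by
  let P := projectiveResolution N
  obtain ⟨S, hS, h₁, h₂, h₃⟩ := exists_shortExact_tensor_resolution hf hg hfg P
  have hA' := (isZero_tor_iff _ P _).1 (hA N)
  have hB' := (isZero_tor_iff _ P _).1 (hB N)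
  rw [isZero_tor_iff _ P]
  rw [← h₁] at hA'
  rw [← h₂] at hB'
  rw [← h₃]
  exact (hS.homology_exact₃ (n + 1) n (by simp)).isZero_of_both_isZero hB' hA'

lemma TorVanishes.of_exact_middle (hA : TorVanishes R n A) (hC : TorVanishes R n C) :
    TorVanishes R n B := fun N => by
  let P := projectiveResolution N
  obtain ⟨S, hS, h₁, h₂, h₃⟩ := exists_shortExact_tensor_resolution hf hg hfg P
  have hA' := (isZero_tor_iff _ P _).1 (hA N)
  have hC' := (isZero_tor_iff _ P _).1 (hC N)
  rw [isZero_tor_iff _ P]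
  rw [← h₁] at hA'
  rw [← h₃] at hC'
  rw [← h₂]
  exact (hS.homology_exact₂ n).isZero_of_both_isZero hA' hC'

lemma TorVanishes.of_exact_left (hC : TorVanishes R (n + 1) C) (hB : TorVanishes R n B) :
    TorVanishes R n A := fun N => by
  let P := projectiveResolution N
  obtain ⟨S, hS, h₁, h₂, h₃⟩ := exists_shortExact_tensor_resolution hf hg hfg P
  have hB' := (isZero_tor_iff _ P _).1 (hB N)
  have hC' := (isZero_tor_iff _ P _).1 (hC N)
  rw [isZero_tor_iff _ P]
  rw [← h₂] at hB'
  rw [← h₃] at hC'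
  rw [← h₁]
  exact (hS.homology_exact₁ (n + 1) n (by simp)).isZero_of_both_isZero hC' hB'

end LongExactSequence

variable {A : Type u} [AddCommGroup A] [Module R A]

lemma ProjectiveResolution.function_exact {N : ModuleCat.{u} R} (P : ProjectiveResolution N)
    (n : ℕ) : Function.Exact (P.complex.d (n + 2) (n + 1)).hom (P.complex.d (n + 1) n).hom :=
  (ShortComplex.ShortExact.moduleCat_exact_iff_function_exact _).1 (P.exact_succ n)

lemma ProjectiveResolution.function_exact_zero {N : ModuleCat.{u} R}
    (P : ProjectiveResolution N) :
    Function.Exact (P.complex.d 1 0).hom (P.π.f 0).hom :=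
  (ShortComplex.ShortExact.moduleCat_exact_iff_function_exact _).1 P.exact₀

lemma TorVanishes.of_flat [Module.Flat R A] (n : ℕ) : TorVanishes R (n + 1) A := fun N => by
  let P := projectiveResolution N
  rw [isZero_tor_succ_iff_exact _ P]
  exact Module.Flat.lTensor_exact A (ProjectiveResolution.function_exact P n)

/-- If `Tor₁(A, N) = 0`, then tensoring with `A` preserves injectivity of the inclusion of the
first syzygy of `N`. -/
lemma lTensor_ker_injective_of_isZero_tor {N : ModuleCat.{u} R} (P : ProjectiveResolution N)
    (h : Limits.IsZero (((Tor (ModuleCat.{u} R) 1).obj (ModuleCat.of R A)).obj N)) :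
    Function.Injective (LinearMap.lTensor A (LinearMap.ker (P.π.f 0).hom).subtype) := by
  have hex := (isZero_tor_succ_iff_exact _ P 0).1 h
  have h0 := ProjectiveResolution.function_exact_zero P
  let d : P.complex.X 1 →ₗ[R] LinearMap.ker (P.π.f 0).hom :=
    (P.complex.d 1 0).hom.codRestrict _ fun x => h0.apply_apply_eq_zero x
  have hd : Function.Surjective d := by
    rintro ⟨y, hy⟩
    obtain ⟨x, hx⟩ := (h0 y).1 hy
    exact ⟨x, Subtype.ext hx⟩
  have hcomp : (LinearMap.ker (P.π.f 0).hom).subtype ∘ₗ d = (P.complex.d 1 0).hom := rfl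
  have hzero : d ∘ₗ (P.complex.d 2 1).hom = 0 :=
    LinearMap.ext fun x =>
      Subtype.ext ((ProjectiveResolution.function_exact P 0).apply_apply_eq_zero x)
  rw [injective_iff_map_eq_zero]
  intro t ht
  obtain ⟨s, rfl⟩ := LinearMap.lTensor_surjective A hd t
  rw [← LinearMap.comp_apply, ← LinearMap.lTensor_comp, hcomp] at ht
  obtain ⟨r, rfl⟩ := (hex s).1 ht
  change (LinearMap.lTensor A d ∘ₗ LinearMap.lTensor A (P.complex.d 2 1).hom) r = 0
  rw [← LinearMap.lTensor_comp, hzero, LinearMap.lTensor_zero, LinearMap.zero_apply]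

lemma weakDim_le_of_torVanishes {n : ℕ} (h : TorVanishes R (n + 1) A) : weakDim R A ≤ n :=
  sInf_le ⟨n, rfl, h⟩

lemma weakDim_eq_zero_of_flat [Module.Flat R A] : weakDim R A = 0 :=
  le_antisymm (by exact_mod_cast weakDim_le_of_torVanishes (TorVanishes.of_flat (A := A) 0))
    bot_le

lemma two_le_weakDim (h₁ : ¬ TorVanishes R 1 A) (h₂ : ¬ TorVanishes R 2 A) :
    2 ≤ weakDim R A := by
  refine le_sInf ?_
  rintro _ ⟨k, rfl, hk⟩
  match k with
  | 0 => exact absurd hk h₁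
  | 1 => exact absurd hk h₂
  | k + 2 => exact_mod_cast Nat.le_add_left 2 k

end TorVanishing

open scoped TensorProduct

section ChainRing

variable {R : Type u} [CommRing R]

lemma IsChainRing.dvd_or_dvd (hR : IsChainRing R) (a b : R) : a ∣ b ∨ b ∣ a :=
  (hR (Ideal.span {b}) (Ideal.span {a})).imp
    Ideal.span_singleton_le_span_singleton.1 Ideal.span_singleton_le_span_singleton.1

/-- If `b` does not divide `a`, then `b` is a multiple of `a` by a nonunit. -/
lemma IsChainRing.exists_mem_maximalIdeal_of_not_dvd [IsLocalRing R] (hR : IsChainRing R) {a b : R}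
    (h : ¬ b ∣ a) : ∃ p ∈ IsLocalRing.maximalIdeal R, b = a * p := by
  obtain ⟨p, rfl⟩ := (hR.dvd_or_dvd b a).resolve_left h
  refine ⟨p, fun hp => h ?_, rfl⟩
  exact (hp.mul_right_dvd).2 dvd_rfl

lemma IsChainRing.isBezout (hR : IsChainRing R) : IsBezout R := by
  rw [IsBezout.iff_span_pair_isPrincipal]
  intro x y
  rcases hR.dvd_or_dvd x y with h | h
  · exact ⟨x, by rw [Ideal.span_pair_comm]; exact Ideal.span_pair_eq_span_right_iff_dvd.2 h⟩
  · exact ⟨y, Ideal.span_pair_eq_span_right_iff_dvd.2 h⟩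

variable {M : Type*} [AddCommGroup M] [Module R M]

/-- Every element of `N ⊗ M` with `N` generated by `n` is of the form `n ⊗ x`. -/
lemma exists_eq_tmul_of_cyclic {N : Type*} [AddCommGroup N] [Module R N] {n : N}
    (hn : ∀ r : N, ∃ c : R, r = c • n) (t : N ⊗[R] M) : ∃ x : M, t = n ⊗ₜ[R] x := by
  induction t using TensorProduct.induction_on with
  | zero => exact ⟨0, by simp⟩
  | tmul r x =>
    obtain ⟨c, rfl⟩ := hn r
    exact ⟨c • x, TensorProduct.smul_tmul _ _ _⟩
  | add s t hs ht =>
    obtain ⟨x, rfl⟩ := hs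
    obtain ⟨y, rfl⟩ := ht
    exact ⟨x + y, (TensorProduct.tmul_add _ _ _).symm⟩

/-- An element of `I • M` is a single product `s • y` with `s ∈ I`. -/
lemma IsChainRing.exists_smul_eq_sum (hR : IsChainRing R) (I : Ideal R) {ι : Type*}
    (t : Finset ι) (s : ι → R) (y : ι → M) (hs : ∀ i ∈ t, s i ∈ I) :
    ∃ c ∈ I, ∃ z : M, ∑ i ∈ t, s i • y i = c • z := by
  classical
  induction t using Finset.induction_on with
  | empty => exact ⟨0, I.zero_mem, 0, by simp⟩
  | insert i t hi ih =>
    obtain ⟨c, hc, z, hz⟩ := ih fun j hj => hs j (Finset.mem_insert_of_mem hj)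
    rw [Finset.sum_insert hi, hz]
    rcases hR.dvd_or_dvd (s i) c with ⟨d, rfl⟩ | ⟨d, hd⟩
    · exact ⟨s i, hs i (Finset.mem_insert_self _ _), y i + d • z, by rw [smul_add, mul_smul]⟩
    · exact ⟨c, hc, d • y i + z, by rw [hd, smul_add, mul_smul]⟩

/-- A pure tensor that vanishes is annihilated for an obvious reason. -/
lemma IsChainRing.exists_of_tmul_eq_zero (hR : IsChainRing R) {N : Type*} [AddCommGroup N]
    [Module R N] {m : M} {n : N}
    (hm : Function.Injective
      (LinearMap.rTensor N (Submodule.span R (Set.range fun _ : Unit => m)).subtype))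
    (h : m ⊗ₜ[R] n = 0) : ∃ s : R, s • m = 0 ∧ ∃ y : N, n = s • y := by
  obtain ⟨k, a, y, hn, ha⟩ := TensorProduct.vanishesTrivially_of_sum_tmul_eq_zero_of_rTensor_injective
    R (m := fun _ : Unit => m) (n := fun _ : Unit => n) hm (by simpa using h)
  obtain ⟨s, hs, z, hz⟩ := hR.exists_smul_eq_sum (Ideal.torsionOf R M m) Finset.univ (a ()) y
    fun j _ => by simpa using ha j
  exact ⟨s, hs, z, (hn ()).trans hz⟩

/-- Flatness over a chain ring is tested on relations with one term. -/
lemma IsChainRing.flat_iff (hR : IsChainRing R) :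
    Module.Flat R M ↔ ∀ (a : R) (x : M), a • x = 0 → ∃ (b : R) (y : M), a * b = 0 ∧ x = b • y := by
  constructor
  · intro hM a x hax
    obtain ⟨κ, c, y, hx, hc⟩ := Module.Flat.isTrivialRelation_of_sum_smul_eq_zero
      (f := fun _ : Unit => a) (x := fun _ : Unit => x) (by simpa using hax)
    obtain ⟨s, hs, z, hz⟩ := hR.exists_smul_eq_sum (Ideal.torsionOf R R a) Finset.univ (c ()) y
      fun j _ => by simpa [mul_comm] using hc j
    exact ⟨s, z, by simpa [mul_comm] using hs, (hx ()).trans hz⟩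
  · intro h
    rw [Module.Flat.iff_lift_lsmul_comp_subtype_injective]
    intro I hI
    have := hR.isBezout
    obtain ⟨a, rfl⟩ := (IsBezout.isPrincipal_of_FG I hI).principal
    rw [injective_iff_map_eq_zero]
    intro t ht
    have hgen : ∀ r : Submodule.span R {a}, ∃ c : R,
        r = c • (⟨a, Submodule.mem_span_singleton_self a⟩ : Submodule.span R {a}) := by
      rintro ⟨r, hr⟩
      obtain ⟨c, rfl⟩ := Submodule.mem_span_singleton.1 hr
      exact ⟨c, rfl⟩
    obtain ⟨x, rfl⟩ := exists_eq_tmul_of_cyclic hgen t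
    obtain ⟨b, y, hab, rfl⟩ := h a x (by simpa using ht)
    have hba : b • (⟨a, Submodule.mem_span_singleton_self a⟩ : Submodule.span R {a}) = 0 :=
      Subtype.ext (by simpa [mul_comm] using hab)
    rw [← TensorProduct.smul_tmul, hba, TensorProduct.zero_tmul]

lemma IsChainRing.flat_of_torVanishes_one {M : Type u} [AddCommGroup M] [Module R M]
    (hR : IsChainRing R) (h : TorVanishes R 1 M) : Module.Flat R M := by
  rw [hR.flat_iff]
  intro a x hax
  let N := ModuleCat.of R (R ⧸ Ideal.span {a})
  let P := projectiveResolution N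
  have : Projective (P.complex.X 0) := P.projective 0
  have hP : Module.Projective R (P.complex.X 0) := (IsProjective.iff_projective _).2 this
  let π : P.complex.X 0 →ₗ[R] R ⧸ Ideal.span {a} := (P.π.f 0).hom
  have hinj : Function.Injective (LinearMap.lTensor M (LinearMap.ker π).subtype) :=
    lTensor_ker_injective_of_isZero_tor P (h N)
  have hπ : Function.Surjective π := (ModuleCat.epi_iff_surjective (P.π.f 0)).1 inferInstance
  obtain ⟨v, hv⟩ := Module.projective_lifting_property (Submodule.mkQ (Ideal.span {a})) π
    (Submodule.mkQ_surjective _)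
  obtain ⟨w, hw⟩ := hπ (Submodule.Quotient.mk 1)
  have hvw : v w - 1 ∈ Ideal.span {a} := by
    have := LinearMap.congr_fun hv w
    rw [← Submodule.Quotient.eq]
    exact this.trans hw
  obtain ⟨r, hr⟩ := Ideal.mem_span_singleton.1 hvw
  have haw : a • w ∈ LinearMap.ker π := by
    rw [LinearMap.mem_ker, map_smul, hw, ← Submodule.Quotient.mk_smul,
      Submodule.Quotient.mk_eq_zero]
    simp
  have hzero : x ⊗ₜ[R] (⟨a • w, haw⟩ : LinearMap.ker π) = 0 := by
    apply hinj
    rw [map_zero]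
    change x ⊗ₜ[R] (a • w) = 0
    rw [← TensorProduct.smul_tmul, hax, TensorProduct.zero_tmul]
  let v' : LinearMap.ker π →ₗ[R] Ideal.span {a} := (v ∘ₗ (LinearMap.ker π).subtype).codRestrict _
    fun k => by
      have := LinearMap.congr_fun hv k
      rw [← Submodule.Quotient.mk_eq_zero]
      exact this.trans k.2
  have hva : v' ⟨a • w, haw⟩ =
      (1 + a * r) • (⟨a, Ideal.mem_span_singleton_self a⟩ : Ideal.span {a}) := by
    refine Subtype.ext ?_
    change v (a • w) = (1 + a * r) * a
    rw [map_smul, smul_eq_mul, mul_comm, ← hr]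
    ring
  have hzero' := congrArg (LinearMap.lTensor M v') hzero
  rw [LinearMap.lTensor_tmul, map_zero, hva, ← TensorProduct.smul_tmul, add_smul, one_smul,
    mul_comm, mul_smul, hax, smul_zero, add_zero] at hzero'
  have hzero'' := congrArg (TensorProduct.comm R M (Ideal.span {a})) hzero'
  rw [TensorProduct.comm_tmul, map_zero] at hzero''
  have hspan : Submodule.span R
      (Set.range fun _ : Unit => (⟨a, Ideal.mem_span_singleton_self a⟩ : Ideal.span {a})) = ⊤ := by
    refine eq_top_iff.2 ?_
    rintro ⟨c, hc⟩ -
    obtain ⟨d, rfl⟩ := Ideal.mem_span_singleton'.1 hc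
    have ha : (⟨a, Ideal.mem_span_singleton_self a⟩ : Ideal.span {a}) ∈ Submodule.span R
        (Set.range fun _ : Unit => (⟨a, Ideal.mem_span_singleton_self a⟩ : Ideal.span {a})) :=
      Submodule.subset_span (Set.mem_range_self ())
    exact Submodule.smul_mem _ d ha
  have hm : Function.Injective (LinearMap.rTensor M (Submodule.span R
      (Set.range fun _ : Unit =>
        (⟨a, Ideal.mem_span_singleton_self a⟩ : Ideal.span {a}))).subtype) := by
    rw [hspan]
    exact (LinearEquiv.rTensor M Submodule.topEquiv).injective
  obtain ⟨s, hs, y, hy⟩ := hR.exists_of_tmul_eq_zero hm hzero''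
  exact ⟨s, y, by simpa [mul_comm] using congrArg (Submodule.subtype _) hs, hy⟩

end ChainRing

section FPInjective

variable {R : Type u} [CommRing R]

/-- Extending maps from the kernel of a projective cover does not depend on the cover. -/
lemma exists_extension_of_surjective {F P Q Y : Type*} [AddCommGroup F] [Module R F]
    [AddCommGroup P] [Module R P] [AddCommGroup Q] [Module R Q] [AddCommGroup Y] [Module R Y]
    [Module.Projective R P] [Module.Projective R Q] {π : P →ₗ[R] F} {ρ : Q →ₗ[R] F}
    (hπ : Function.Surjective π) (hρ : Function.Surjective ρ)
    (h : ∀ φ : LinearMap.ker π →ₗ[R] Y, ∃ ψ : P →ₗ[R] Y, ∀ k : LinearMap.ker π, ψ k = φ k)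
    (φ : LinearMap.ker ρ →ₗ[R] Y) : ∃ ψ : Q →ₗ[R] Y, ∀ k : LinearMap.ker ρ, ψ k = φ k := by
  obtain ⟨v, hv⟩ := Module.projective_lifting_property π ρ hπ
  obtain ⟨w, hw⟩ := Module.projective_lifting_property ρ π hρ
  replace hv := fun x => LinearMap.congr_fun hv x
  replace hw := fun x => LinearMap.congr_fun hw x
  simp only [LinearMap.comp_apply] at hv hw
  let w' : LinearMap.ker π →ₗ[R] LinearMap.ker ρ :=
    w.restrict fun x (hx : π x = 0) => show ρ (w x) = 0 by rw [hw, hx]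
  let e : Q →ₗ[R] LinearMap.ker ρ := (LinearMap.id - w ∘ₗ v).codRestrict _ fun x => by
    simp [hv, hw]
  obtain ⟨ψ, hψ⟩ := h (φ ∘ₗ w')
  refine ⟨ψ ∘ₗ v + φ ∘ₗ e, fun k => ?_⟩
  have hk : v k ∈ LinearMap.ker π := by rw [LinearMap.mem_ker, hv]; exact k.2
  have h1 : ψ (v k) = φ (w' ⟨v k, hk⟩) := hψ ⟨v k, hk⟩
  rw [LinearMap.add_apply, LinearMap.comp_apply, h1, LinearMap.comp_apply, ← map_add]
  congr 1
  refine Subtype.ext ?_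
  change w (v k) + ((k : Q) - w (v k)) = k
  abel

/-- `Ext¹(F, Y) = 0` means that maps to `Y` extend from the first syzygy of `F`. -/
lemma isZero_ext_one_iff {F Y : ModuleCat.{u} R} (P : ProjectiveResolution F) :
    Limits.IsZero (((Ext R (ModuleCat.{u} R) 1).obj (Opposite.op F)).obj Y) ↔
      ∀ φ : LinearMap.ker (P.π.f 0).hom →ₗ[R] Y, ∃ ψ : P.complex.X 0 →ₗ[R] Y,
        ∀ k : LinearMap.ker (P.π.f 0).hom, ψ k = φ k := by
  have h0 := ProjectiveResolution.function_exact_zero P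
  have h1 := ProjectiveResolution.function_exact P 0
  have key : Limits.IsZero (((Ext R (ModuleCat.{u} R) 1).obj (Opposite.op F)).obj Y) ↔
      ∀ φ : P.complex.X 1 ⟶ Y, P.complex.d 2 1 ≫ φ = 0 →
        ∃ ψ : P.complex.X 0 ⟶ Y, P.complex.d 1 0 ≫ ψ = φ := by
    rw [(P.isoExt (R := R) 1 Y).isZero_iff, ← HomologicalComplex.exactAt_iff_isZero_homology,
      HomologicalComplex.exactAt_iff' _ 0 1 2 (by simp) (by simp),
      ShortComplex.moduleCat_exact_iff]
    rfl
  rw [key]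
  let d : P.complex.X 1 →ₗ[R] LinearMap.ker (P.π.f 0).hom :=
    (P.complex.d 1 0).hom.codRestrict _ fun x => h0.apply_apply_eq_zero x
  have hd : Function.Surjective d := by
    rintro ⟨y, hy⟩
    obtain ⟨x, hx⟩ := (h0 y).1 hy
    exact ⟨x, Subtype.ext hx⟩
  constructor
  · intro h φ
    obtain ⟨ψ, hψ⟩ := h (ModuleCat.ofHom (φ ∘ₗ d)) (by
      ext x
      change φ (d ((P.complex.d 2 1).hom x)) = 0
      rw [show d ((P.complex.d 2 1).hom x) = 0 from Subtype.ext (h1.apply_apply_eq_zero x),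
        map_zero])
    refine ⟨ψ.hom, fun k => ?_⟩
    obtain ⟨x, rfl⟩ := hd k
    exact congrArg (fun f : P.complex.X 1 ⟶ Y => f.hom x) hψ
  · intro h φ hφ
    have hker : LinearMap.ker d ≤ LinearMap.ker φ.hom := by
      intro x hx
      obtain ⟨y, rfl⟩ := (h1 x).1 (congrArg Subtype.val hx)
      exact congrArg (fun f : P.complex.X 2 ⟶ Y => f.hom y) hφ
    let e := d.quotKerEquivOfSurjective hd
    obtain ⟨ψ, hψ⟩ := h ((LinearMap.ker d).liftQ φ.hom hker ∘ₗ e.symm.toLinearMap)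
    refine ⟨ModuleCat.ofHom ψ, ?_⟩
    ext x
    refine (hψ (d x)).trans ?_
    have : e.symm (d x) = Submodule.Quotient.mk x := by
      rw [LinearEquiv.symm_apply_eq]
      rfl
    rw [LinearMap.comp_apply, LinearEquiv.coe_coe, this]
    rfl

lemma isZero_ext_one_iff_of_surjective {F Y : ModuleCat.{u} R} {Q : Type*} [AddCommGroup Q]
    [Module R Q] [Module.Projective R Q] {ρ : Q →ₗ[R] F} (hρ : Function.Surjective ρ) :
    Limits.IsZero (((Ext R (ModuleCat.{u} R) 1).obj (Opposite.op F)).obj Y) ↔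
      ∀ φ : LinearMap.ker ρ →ₗ[R] Y, ∃ ψ : Q →ₗ[R] Y, ∀ k : LinearMap.ker ρ, ψ k = φ k := by
  let P := projectiveResolution F
  have : Projective (P.complex.X 0) := P.projective 0
  have hP : Module.Projective R (P.complex.X 0) := (IsProjective.iff_projective _).2 this
  have hπ : Function.Surjective (P.π.f 0).hom :=
    (ModuleCat.epi_iff_surjective (P.π.f 0)).1 inferInstance
  rw [isZero_ext_one_iff P]
  exact ⟨exists_extension_of_surjective hπ hρ, exists_extension_of_surjective hρ hπ⟩

variable {E : Type u} [AddCommGroup E] [Module R E]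

lemma IsFPInjective.exists_eq_smul (hE : IsFPInjective R E) {a : R} {x : E}
    (hax : ∀ b : R, a * b = 0 → b • x = 0) : ∃ y : E, x = a • y := by
  have hfp : Module.FinitePresentation R (R ⧸ Ideal.span {a}) :=
    Module.finitePresentation_of_free_of_surjective (Submodule.mkQ (Ideal.span {a}))
      (Submodule.mkQ_surjective _) (by rw [Submodule.ker_mkQ]; exact ⟨{a}, by simp⟩)
  have hext := (isZero_ext_one_iff_of_surjective (F := ModuleCat.of R (R ⧸ Ideal.span {a}))
    (Submodule.mkQ_surjective (Ideal.span {a}))).1 (hE _ hfp)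
  have hker : ∀ k : LinearMap.ker (Submodule.mkQ (Ideal.span {a})), ∃ r : R, r * a = k := by
    rintro ⟨k, hk⟩
    rw [Submodule.ker_mkQ] at hk
    exact Ideal.mem_span_singleton'.1 hk
  choose r hr using hker
  have hwd : ∀ s t : R, s * a = t * a → s • x = t • x := fun s t hst => by
    rw [← sub_eq_zero, ← sub_smul]
    exact hax _ (by linear_combination hst)
  obtain ⟨ψ, hψ⟩ := hext
    { toFun := fun k => r k • x
      map_add' := fun k l => by
        rw [← add_smul]
        exact hwd _ _ (by rw [hr, add_mul, hr, hr]; rfl)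
      map_smul' := fun c k => by
        rw [RingHom.id_apply, ← mul_smul]
        exact hwd _ _ (by rw [hr, mul_assoc, hr]; rfl) }
  have hmem : a ∈ LinearMap.ker (Submodule.mkQ (Ideal.span {a})) := by
    rw [Submodule.ker_mkQ]
    exact Ideal.mem_span_singleton_self a
  refine ⟨ψ 1, ?_⟩
  have h1 := hψ ⟨a, hmem⟩
  have h2 : r ⟨a, hmem⟩ • x = (1 : R) • x := hwd _ _ (by rw [hr, one_mul])
  rw [← map_smul, smul_eq_mul, mul_one]
  exact (h1.trans (h2.trans (one_smul R x))).symm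

lemma IsChainRing.exists_dvd_all (hR : IsChainRing R) {ι : Type*} (t : Finset ι)
    (ht : t.Nonempty) (f : ι → R) : ∃ i ∈ t, ∀ j ∈ t, f i ∣ f j := by
  classical
  induction ht using Finset.Nonempty.cons_induction with
  | singleton i => exact ⟨i, by simp, by simp⟩
  | cons i t hi ht ih =>
    obtain ⟨j, hj, hjt⟩ := ih
    rcases hR.dvd_or_dvd (f i) (f j) with h | h
    · exact ⟨i, by simp, fun k hk => (Finset.mem_cons.1 hk).elim (fun e => e ▸ dvd_rfl)
        fun hk => h.trans (hjt k hk)⟩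
    · exact ⟨j, by simp [hj], fun k hk => (Finset.mem_cons.1 hk).elim (fun e => e ▸ h)
        fun hk => hjt k hk⟩

/-- Over a chain ring, solvability of finite linear systems in `E` follows from that of single
equations in one unknown, by Gaussian elimination. -/
lemma IsChainRing.exists_solution (hR : IsChainRing R) {E : Type*} [AddCommGroup E] [Module R E]
    (hE : ∀ (a : R) (x : E), (∀ b : R, a * b = 0 → b • x = 0) → ∃ y : E, x = a • y)
    {ι κ : Type*} [Fintype ι] [Fintype κ] [DecidableEq ι] [DecidableEq κ] (S : Finset ι) :
    ∀ (A : κ → ι → R) (b : ι → E), (∀ i, ∀ j ∉ S, A i j = 0) → (∀ j ∉ S, b j = 0) →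
      (∀ v : ι → R, (∀ i, ∑ j, v j * A i j = 0) → ∑ j, v j • b j = 0) →
      ∃ y : κ → E, ∀ j, b j = ∑ i, A i j • y i := by
  induction S using Finset.strongInduction with
  | H S ih =>
  intro A b hA hb h
  rcases (Finset.univ ×ˢ S : Finset (κ × ι)).eq_empty_or_nonempty with hS | hS
  · refine ⟨0, fun j => ?_⟩
    have hA0 : ∀ i j, A i j = 0 := fun i j => by
      refine hA i j fun hj => ?_
      have : (i, j) ∈ (Finset.univ ×ˢ S : Finset (κ × ι)) := by simp [hj]
      simp [hS] at this
    have := h (Pi.single j 1) (by simp [hA0])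
    simpa [Pi.single_apply, ite_smul] using this
  obtain ⟨⟨i₀, j₀⟩, hij, hdvd⟩ := hR.exists_dvd_all _ hS fun p => A p.1 p.2
  have hj₀ : j₀ ∈ S := by simpa using hij
  set d := A i₀ j₀ with hd
  have hdvd' : ∀ i j, d ∣ A i j := fun i j => by
    by_cases hj : j ∈ S
    · exact hdvd (i, j) (by simp [hj])
    · rw [hA i j hj]; exact dvd_zero d
  choose c hc using fun i => hdvd' i j₀
  obtain ⟨w, hw⟩ : ∃ w : ι → R, w j₀ = 1 ∧ ∀ j, A i₀ j = d * w j := by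
    choose w hw using hdvd' i₀
    refine ⟨Function.update w j₀ 1, by simp, fun j => ?_⟩
    by_cases hj : j = j₀
    · subst hj; simp [hd]
    · simp [hj, hw]
  obtain ⟨hw₀, hw⟩ := hw
  obtain ⟨z, hz⟩ := hE d (b j₀) fun s hs => by
    have := h (Pi.single j₀ s) fun i => by
      simp only [Pi.single_apply, ite_mul, zero_mul, Finset.sum_ite_eq', Finset.mem_univ, if_true]
      rw [hc, ← mul_assoc, mul_comm s, hs, zero_mul]
    simpa [Pi.single_apply, ite_smul] using this
  have hA' : ∀ i, ∀ j ∉ S.erase j₀, A i j - c i * A i₀ j = 0 := by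
    intro i j hj
    by_cases hjj : j = j₀
    · subst hjj
      rw [hc i]; ring
    · have hjS : j ∉ S := fun hS' => hj (Finset.mem_erase.2 ⟨hjj, hS'⟩)
      simp [hA _ j hjS]
  have hb' : ∀ j ∉ S.erase j₀, b j - A i₀ j • z = 0 := by
    intro j hj
    by_cases hjj : j = j₀
    · subst hjj
      rw [hz, sub_self]
    · have hjS : j ∉ S := fun hS' => hj (Finset.mem_erase.2 ⟨hjj, hS'⟩)
      simp [hA _ j hjS, hb j hjS]
  have h' : ∀ v : ι → R, (∀ i, ∑ j, v j * (A i j - c i * A i₀ j) = 0) →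
      ∑ j, v j • (b j - A i₀ j • z) = 0 := by
    intro v hv
    set t := ∑ j, v j * w j with ht
    have hsub : ∀ f : ι → R,
        ∑ j, (v - Pi.single j₀ t : ι → R) j * f j = ∑ j, v j * f j - t * f j₀ := by
      intro f
      simp [sub_mul, Finset.sum_sub_distrib, Pi.single_apply, ite_mul]
    have hsub' : ∀ f : ι → E,
        ∑ j, (v - Pi.single j₀ t : ι → R) j • f j = ∑ j, v j • f j - t • f j₀ := by
      intro f
      simp [sub_smul, Finset.sum_sub_distrib, Pi.single_apply, ite_smul]
    have h₀ : ∑ j, (v - Pi.single j₀ t : ι → R) j * A i₀ j = 0 := by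
      rw [hsub, ← hd]
      simp only [hw]
      rw [Finset.sum_congr rfl fun j _ => mul_left_comm (v j) d (w j), ← Finset.mul_sum, ← ht]
      ring
    have h₁ := h (v - Pi.single j₀ t) fun i => by
      have h₂ := hv i
      simp only [mul_sub, Finset.sum_sub_distrib] at h₂
      have h₃ : ∑ j, v j * (c i * A i₀ j) = c i * ∑ j, v j * A i₀ j := by
        rw [Finset.mul_sum]
        exact Finset.sum_congr rfl fun j _ => mul_left_comm _ _ _
      rw [h₃] at h₂
      rw [hsub] at h₀ ⊢
      rw [hc i]
      linear_combination h₂ + c i * h₀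
    rw [hsub'] at h₁
    rw [hsub] at h₀
    simp only [smul_sub, Finset.sum_sub_distrib]
    have h₄ : ∑ j, v j • A i₀ j • z = (∑ j, v j * A i₀ j) • z := by
      rw [Finset.sum_smul]
      exact Finset.sum_congr rfl fun j _ => (mul_smul _ _ _).symm
    rw [h₄, sub_eq_zero.1 h₁, sub_eq_zero.1 h₀, hz, mul_smul, sub_self]
  obtain ⟨y, hy⟩ := ih (S.erase j₀) (Finset.erase_ssubset hj₀)
    (fun i j => A i j - c i * A i₀ j) (fun j => b j - A i₀ j • z) hA' hb' h'
  refine ⟨y + Pi.single i₀ (z - ∑ i, c i • y i), fun j => ?_⟩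
  have hsingle : ∑ i, A i j • (Pi.single i₀ (z - ∑ i, c i • y i) : κ → E) i =
      A i₀ j • (z - ∑ i, c i • y i) := by
    rw [Finset.sum_eq_single i₀] <;> simp +contextual
  have := hy j
  simp only [sub_smul, Finset.sum_sub_distrib] at this
  have hcomm : ∑ i, (c i * A i₀ j) • y i = A i₀ j • ∑ i, c i • y i := by
    rw [Finset.smul_sum]
    exact Finset.sum_congr rfl fun i _ => by rw [mul_comm, mul_smul]
  rw [hcomm, sub_eq_iff_eq_add] at this
  simp only [Pi.add_apply, smul_add, Finset.sum_add_distrib]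
  rw [hsingle, this, smul_sub]
  abel

lemma IsChainRing.isFPInjective (hR : IsChainRing R)
    (hE : ∀ (a : R) (x : E), (∀ b : R, a * b = 0 → b • x = 0) → ∃ y : E, x = a • y) :
    IsFPInjective R E := by
  intro F hF
  obtain ⟨n, m, f, g, hf, hfg⟩ := Module.FinitePresentation.exists_fin' R F
  rw [isZero_ext_one_iff_of_surjective hf]
  intro φ
  let g' : (Fin m → R) →ₗ[R] LinearMap.ker f :=
    g.codRestrict _ fun x => hfg.apply_apply_eq_zero x
  have hsum : ∀ v : Fin m → R, v = ∑ j, v j • (Pi.single j 1 : Fin m → R) := fun v =>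
    pi_eq_sum_univ' v
  obtain ⟨y, hy⟩ := hR.exists_solution hE Finset.univ
    (fun i j => g (Pi.single j 1) i) (fun j => φ (g' (Pi.single j 1))) (by simp) (by simp)
    fun v hv => by
      have hgv : g' v = 0 := by
        refine Subtype.ext (funext fun i => ?_)
        change g v i = 0
        rw [← hv i]
        conv_lhs => rw [hsum v]
        simp [map_sum, Finset.sum_apply]
      rw [← map_zero φ, ← hgv]
      conv_rhs => rw [hsum v]
      simp [map_sum]
  refine ⟨Fintype.linearCombination R y, ?_⟩
  rintro ⟨k, hk⟩
  obtain ⟨v, rfl⟩ := (hfg k).1 hk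
  change (Fintype.linearCombination R y ∘ₗ g) v = (φ ∘ₗ g') v
  congr 1
  refine LinearMap.pi_ext' fun j => LinearMap.ext_ring ?_
  simp [Fintype.linearCombination_apply, hy]

/-- Over a self FP-injective chain ring every flat module is almost FP-injective. -/
lemma IsChainRing.isAlmostFPInjective_of_flat (hR : IsChainRing R)
    (hself : ∀ a x : R, (∀ b : R, a * b = 0 → b * x = 0) → a ∣ x)
    (M : Type u) [AddCommGroup M] [Module R M] [Module.Flat R M] : IsAlmostFPInjective R M := by
  let q : (M →₀ R) →ₗ[R] M := Finsupp.linearCombination R id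
  have hq : Function.Surjective q := Finsupp.linearCombination_id_surjective R M
  refine ⟨M →₀ R, inferInstance, inferInstance, LinearMap.ker q, ?_, ?_,
    ⟨q.quotKerEquivOfSurjective hq⟩⟩
  · refine hR.isFPInjective fun a x hx => ?_
    have : ∀ i, ∃ c, x i = a * c := fun i =>
      hself a (x i) fun b hb => DFunLike.congr_fun (hx b hb) i
    choose c hc using this
    refine ⟨∑ i ∈ x.support, Finsupp.single i (c i), ?_⟩
    conv_lhs => rw [← x.sum_single]
    simp [Finsupp.sum, Finset.smul_sum, hc]
  · intro N _ _
    have hex : Function.Exact (LinearMap.ker q).subtype q := LinearMap.exact_subtype_ker_map q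
    have := LinearMap.lTensor_injective_of_exact_of_flat (M := LinearMap.ker q) q hq
      (LinearMap.ker q).subtype (Submodule.injective_subtype _) hex N
    exact (LinearMap.lTensor_inj_iff_rTensor_inj _ _).1 this

end FPInjective

section ArchimedeanChainRing

open IsLocalRing

variable {R : Type u} [CommRing R]

lemma finitePresentation_span_singleton_iff (c : R) :
    Module.FinitePresentation R (Ideal.span {c}) ↔ (Ideal.torsionOf R R c).FG := by
  let f : R →ₗ[R] Ideal.span {c} :=
    LinearMap.toSpanSingleton R _ ⟨c, Ideal.mem_span_singleton_self c⟩
  have hf : Function.Surjective f := by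
    rintro ⟨x, hx⟩
    obtain ⟨r, rfl⟩ := Ideal.mem_span_singleton'.1 hx
    exact ⟨r, rfl⟩
  have hker : LinearMap.ker f = Ideal.torsionOf R R c := by
    ext r
    exact Subtype.ext_iff
  rw [← hker]
  exact ⟨fun _ => Module.FinitePresentation.fg_ker f hf,
    Module.finitePresentation_of_free_of_surjective f hf⟩

lemma IsChainRing.isCoherentRing_iff (hR : IsChainRing R) :
    IsCoherentRing R ↔ ∀ c : R, ∃ d : R, ∀ y : R, c * y = 0 ↔ d ∣ y := by
  have hB := hR.isBezout
  constructor
  · intro h c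
    have hfg := (finitePresentation_span_singleton_iff c).1 (h _ ⟨{c}, by simp⟩)
    obtain ⟨d, hd⟩ := (IsBezout.isPrincipal_of_FG _ hfg).principal
    refine ⟨d, fun y => ?_⟩
    rw [← Ideal.mem_span_singleton, Ideal.span, ← hd, Ideal.mem_torsionOf_iff, smul_eq_mul,
      mul_comm]
  · intro h I hI
    obtain ⟨c, rfl⟩ := (IsBezout.isPrincipal_of_FG I hI).principal
    refine (finitePresentation_span_singleton_iff c).2 ?_
    obtain ⟨d, hd⟩ := h c
    refine ⟨{d}, ?_⟩
    ext y
    rw [Finset.coe_singleton, Ideal.mem_torsionOf_iff, smul_eq_mul, mul_comm, hd]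
    exact Ideal.mem_span_singleton

lemma IsChainRing.isCoherentRing_of_isDomain (hR : IsChainRing R) [IsDomain R] :
    IsCoherentRing R := by
  rw [hR.isCoherentRing_iff]
  intro c
  by_cases hc : c = 0
  · exact ⟨1, by simp [hc]⟩
  · exact ⟨0, by simp [hc]⟩

variable [IsLocalRing R]

lemma eq_zero_of_eq_mul_mem_maximalIdeal {x p : R} (hp : p ∈ maximalIdeal R) (h : x = x * p) :
    x = 0 := by
  have hu : IsUnit (1 - p) := by
    by_contra hu
    refine (mem_maximalIdeal _).1 ?_ (isUnit_one (M := R))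
    have := (maximalIdeal R).add_mem ((mem_maximalIdeal _).2 hu) hp
    rwa [sub_add_cancel] at this
  exact hu.mul_left_eq_zero.1 (by linear_combination h)

lemma isNilpotent_of_mem_maximalIdeal
    (harch : ∀ I : Ideal R, I.IsPrime → I ≠ ⊥ → I = maximalIdeal R) (hD : ¬ IsDomain R)
    {a : R} (ha : a ∈ maximalIdeal R) : IsNilpotent a := by
  rw [nilpotent_iff_mem_prime]
  intro J hJ
  by_cases h : J = ⊥
  · subst h
    exact absurd (IsDomain.of_bot_isPrime R) hD
  · rwa [harch J hJ h]

lemma exists_ne_zero_mul_eq_zero_of_isNilpotent {a : R} (ha : IsNilpotent a) :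
    ∃ s : R, s ≠ 0 ∧ a * s = 0 := by
  classical
  have hn := Nat.find_spec ha
  have h0 : Nat.find ha ≠ 0 := fun h => by simp [h] at hn
  obtain ⟨m, hm⟩ := Nat.exists_eq_succ_of_ne_zero h0
  refine ⟨a ^ m, Nat.find_min ha (by omega), ?_⟩
  rw [← pow_succ', ← Nat.succ_eq_add_one, ← hm, hn]

/-- A chain ring with nil maximal ideal is self FP-injective. -/
lemma IsChainRing.dvd_of_annihilator (hR : IsChainRing R)
    (hnil : ∀ a ∈ maximalIdeal R, IsNilpotent a) {a r : R}
    (h : ∀ b : R, a * b = 0 → b * r = 0) : a ∣ r := by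
  by_contra har
  obtain ⟨t, ht, rfl⟩ := hR.exists_mem_maximalIdeal_of_not_dvd har
  have hrt : r * t ≠ 0 := fun h0 => har (by
    have := h 1 (by rw [h0, zero_mul])
    rw [one_mul] at this
    rw [this]; exact dvd_zero _)
  have hstep : ∀ x, r * x = 0 → ∃ y, r * y = 0 ∧ x = t * y := by
    intro x hx
    rcases hR.dvd_or_dvd t x with ⟨y, rfl⟩ | ⟨y, rfl⟩
    · exact ⟨y, by rw [mul_comm]; exact h y (by rw [mul_assoc, hx]), rfl⟩
    · exact absurd (by rw [← mul_assoc, hx, zero_mul]) hrt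
  have hpow : ∀ n x, r * x = 0 → ∃ y, r * y = 0 ∧ x = t ^ n * y := by
    intro n
    induction n with
    | zero => exact fun x hx => ⟨x, hx, by simp⟩
    | succ n ih =>
      intro x hx
      obtain ⟨y, hy, rfl⟩ := ih x hx
      obtain ⟨z, hz, rfl⟩ := hstep y hy
      exact ⟨z, hz, by ring⟩
  obtain ⟨n, hn⟩ := hnil t ht
  obtain ⟨s, hs, hs0⟩ := exists_ne_zero_mul_eq_zero_of_isNilpotent
    (hnil _ (Ideal.mul_mem_left _ r ht))
  obtain ⟨y, -, hy⟩ := hpow n s (by rw [mul_comm]; exact h s hs0)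
  exact hs (by rw [hy, hn, zero_mul])

lemma IsChainRing.exists_annihilator_factor (hR : IsChainRing R)
    (hnil : ∀ a ∈ maximalIdeal R, IsNilpotent a) (hcoh : ¬ IsCoherentRing R) {a x : R}
    (ha : a ≠ 0) (haP : a ∈ maximalIdeal R) (hax : a * x = 0) :
    ∃ b p : R, p ∈ maximalIdeal R ∧ a * b = 0 ∧ x = b * p := by
  by_contra! hne
  refine hcoh (hR.isCoherentRing_iff.2 fun c => ?_)
  have hx : ∀ y, a * y = 0 → x ∣ y := by
    intro y hy
    by_contra hxy
    obtain ⟨p, hp, hxp⟩ := hR.exists_mem_maximalIdeal_of_not_dvd hxy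
    exact hne y p hp hy hxp
  have hx0 : x ≠ 0 := by
    rintro rfl
    obtain ⟨s, hs, has⟩ := exists_ne_zero_mul_eq_zero_of_isNilpotent (hnil a haP)
    exact hs (zero_dvd_iff.1 (hx s has))
  by_cases hc : c = 0
  · exact ⟨1, by simp [hc]⟩
  rcases hR.dvd_or_dvd a c with ⟨d, rfl⟩ | ⟨d, rfl⟩
  · obtain ⟨e, rfl⟩ := (hR.dvd_or_dvd d x).resolve_right fun ⟨e, he⟩ =>
      hc (by rw [he, ← mul_assoc, hax, zero_mul])
    have hde : ∀ z, d * z = 0 → e ∣ z := by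
      intro z hz
      refine (hR.dvd_or_dvd e z).resolve_right fun ⟨w, hw⟩ => hx0 ?_
      rw [hw, ← mul_assoc, hz, zero_mul]
    refine ⟨e, fun y => ⟨fun hy => ?_, ?_⟩⟩
    · obtain ⟨t, ht⟩ := hx (d * y) (by rw [← mul_assoc, hy])
      have := hde (y - e * t) (by linear_combination ht)
      exact (dvd_sub_left (dvd_mul_right e t)).1 this
    · rintro ⟨w, rfl⟩
      linear_combination w * hax
  · refine ⟨d * x, fun y => ⟨fun hy => ?_, ?_⟩⟩
    · obtain ⟨z, rfl⟩ := (hR.dvd_or_dvd d y).resolve_right fun ⟨z, hz⟩ =>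
        ha (by rw [hz, ← mul_assoc, hy, zero_mul])
      exact mul_dvd_mul_left d (hx z (by rw [mul_assoc, hy]))
    · rintro ⟨w, rfl⟩
      linear_combination w * hax

variable (hR : IsChainRing R) (hnil : ∀ a ∈ maximalIdeal R, IsNilpotent a)
  (hcoh : ¬ IsCoherentRing R)
include hR hnil hcoh

/-- Annihilators of nonzero elements of the maximal ideal are not principal. -/
lemma not_annihilator_principal {a d : R} (ha : a ≠ 0) (haP : a ∈ maximalIdeal R)
    (h : ∀ y : R, a * y = 0 ↔ d ∣ y) : False := by
  obtain ⟨b, p, hp, hb, hd⟩ := hR.exists_annihilator_factor hnil hcoh ha haP ((h d).2 dvd_rfl)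
  obtain ⟨t, rfl⟩ := (h b).1 hb
  have hd0 : d = 0 := eq_zero_of_eq_mul_mem_maximalIdeal (Ideal.mul_mem_left _ t hp)
    (by linear_combination hd)
  obtain ⟨s, hs, has⟩ := exists_ne_zero_mul_eq_zero_of_isNilpotent (hnil a haP)
  exact hs (zero_dvd_iff.1 (hd0 ▸ (h s).1 has))

lemma exists_mul_of_mem_maximalIdeal {p : R} (hp : p ∈ maximalIdeal R) :
    ∃ p₁ ∈ maximalIdeal R, ∃ q ∈ maximalIdeal R, p = p₁ * q := by
  by_contra! hne
  by_cases hp0 : p = 0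
  · exact hne 0 (zero_mem _) 0 (zero_mem _) (by simp [hp0])
  obtain ⟨c, hc, hpc⟩ := exists_ne_zero_mul_eq_zero_of_isNilpotent (hnil p hp)
  have hcP : c ∈ maximalIdeal R := by
    rw [mem_maximalIdeal]
    exact fun hu => hp0 (hu.mul_left_eq_zero.1 hpc)
  refine not_annihilator_principal hR hnil hcoh (d := p) hc hcP fun y => ⟨fun hy => ?_, ?_⟩
  · by_contra hpy
    obtain ⟨q, hq, hpq⟩ := hR.exists_mem_maximalIdeal_of_not_dvd hpy
    refine hne y ?_ q hq hpq
    rw [mem_maximalIdeal]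
    exact fun hu => hc (hu.mul_left_eq_zero.1 hy)
  · rintro ⟨w, rfl⟩
    linear_combination w * hpc

lemma exists_common_mul_of_mem_maximalIdeal {p p' : R} (hp : p ∈ maximalIdeal R)
    (hp' : p' ∈ maximalIdeal R) : ∃ p₁ ∈ maximalIdeal R, ∃ q ∈ maximalIdeal R,
      ∃ q' ∈ maximalIdeal R, p = p₁ * q ∧ p' = p₁ * q' := by
  rcases hR.dvd_or_dvd p p' with ⟨w, rfl⟩ | ⟨w, rfl⟩
  · obtain ⟨p₁, h₁, q, hq, rfl⟩ := exists_mul_of_mem_maximalIdeal hR hnil hcoh hp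
    exact ⟨p₁, h₁, q, hq, q * w, Ideal.mul_mem_right _ _ hq, rfl, by ring⟩
  · obtain ⟨p₁, h₁, q, hq, rfl⟩ := exists_mul_of_mem_maximalIdeal hR hnil hcoh hp'
    exact ⟨p₁, h₁, q * w, Ideal.mul_mem_right _ _ hq, q, hq, by ring, rfl⟩
omit hR hnil hcoh

omit [IsLocalRing R] in
/-- Relations lift along the projection `E → G` with pure kernel. -/
lemma IsAlmostFPInjective.exists_projection {G : Type u} [AddCommGroup G] [Module R G]
    (hG : IsAlmostFPInjective R G) :
    ∃ (E : Type u) (_ : AddCommGroup E) (_ : Module R E) (π : E →ₗ[R] G), IsFPInjective R E ∧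
      ∀ (c : R) (x : G), c • x = 0 → ∃ e : E, π e = x ∧ c • e = 0 := by
  obtain ⟨E, _, _, D, hE, hD, ⟨φ⟩⟩ := hG
  refine ⟨E, inferInstance, inferInstance, φ.toLinearMap ∘ₗ D.mkQ, hE, fun c x hcx => ?_⟩
  obtain ⟨e, he⟩ := D.mkQ_surjective (φ.symm x)
  have hce : c • e ∈ D := by
    rw [← Submodule.Quotient.mk_eq_zero, Submodule.Quotient.mk_smul, ← Submodule.mkQ_apply, he,
      ← map_smul, hcx, map_zero]
  have hzero : (⟨c • e, hce⟩ : D) ⊗ₜ[R] (Submodule.Quotient.mk 1 : R ⧸ Ideal.span {c}) = 0 := by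
    apply hD (R ⧸ Ideal.span {c})
    rw [map_zero]
    change (c • e) ⊗ₜ[R] (Submodule.Quotient.mk 1 : R ⧸ Ideal.span {c}) = 0
    rw [TensorProduct.smul_tmul, ← Submodule.Quotient.mk_smul,
      (Submodule.Quotient.mk_eq_zero _).2 (by simp), TensorProduct.tmul_zero]
  have hmk := congrArg (TensorProduct.tensorQuotEquivQuotSMul D (Ideal.span {c})) hzero
  rw [map_zero] at hmk
  replace hmk := (TensorProduct.tensorQuotEquivQuotSMul_tmul_mk (Ideal.span {c})
    (⟨c • e, hce⟩ : D) 1).symm.trans hmk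
  rw [one_smul, Submodule.Quotient.mk_eq_zero, Submodule.ideal_span_singleton_smul,
    Submodule.mem_smul_pointwise_iff_exists] at hmk
  obtain ⟨d, -, hd⟩ := hmk
  have hd' : c • (d : E) = c • e := congrArg Subtype.val hd
  refine ⟨e - d, ?_, by rw [smul_sub, hd', sub_self]⟩
  rw [map_sub, LinearMap.comp_apply, LinearMap.comp_apply, he, D.mkQ_apply d,
    (Submodule.Quotient.mk_eq_zero D).2 d.2]
  simp

variable {G : Type u} [AddCommGroup G] [Module R G] (hG : IsAlmostFPInjective R G)
include hG

omit [IsLocalRing R] in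
lemma IsAlmostFPInjective.exists_eq_smul {b c : R} {x : G} (hcx : c • x = 0)
    (hbc : ∀ r : R, b * r = 0 → c ∣ r) : ∃ y : G, x = b • y := by
  obtain ⟨E, _, _, π, hE, hπ⟩ := hG.exists_projection
  obtain ⟨e, rfl, hce⟩ := hπ c x hcx
  obtain ⟨y, rfl⟩ := hE.exists_eq_smul (a := b) (x := e) fun r hr => by
    obtain ⟨t, rfl⟩ := hbc r hr
    rw [mul_comm, mul_smul, hce, smul_zero]
  exact ⟨π y, map_smul π b y⟩

omit [IsLocalRing R] in
lemma IsAlmostFPInjective.flat_of_isIFRing (hR : IsChainRing R) (hIF : IsIFRing R) :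
    Module.Flat R G := by
  rw [hR.flat_iff]
  intro a x hax
  obtain ⟨E, _, _, π, hE, hπ⟩ := hG.exists_projection
  obtain ⟨e, rfl, hae⟩ := hπ a x hax
  let J := Injective.under (ModuleCat.of R E)
  let ι : E →ₗ[R] J := (Injective.ι (ModuleCat.of R E)).hom
  have hι : Function.Injective ι := (ModuleCat.mono_iff_injective _).1 (Injective.ι_mono _)
  have : Injective (ModuleCat.of R J) := Injective.injective_under _
  have hJ : Module.Flat R J := hIF J (Module.injective_module_of_injective_object R J)
  obtain ⟨b, y, hab, hy⟩ := hR.flat_iff.1 hJ a (ι e) (by rw [← map_smul, hae, map_zero])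
  obtain ⟨z, rfl⟩ := hE.exists_eq_smul (a := b) (x := e) fun r hr => hι (by
    rw [map_smul, hy, map_zero, ← mul_smul, mul_comm, hr, zero_smul])
  exact ⟨b, π z, hab, map_smul π b z⟩

lemma IsAlmostFPInjective.flat_of_isCoherentRing (hR : IsChainRing R)
    (hnil : ∀ a ∈ maximalIdeal R, IsNilpotent a) (hcoh : IsCoherentRing R) :
    Module.Flat R G := by
  rw [hR.flat_iff]
  intro a x hax
  obtain ⟨b, hb⟩ := hR.isCoherentRing_iff.1 hcoh a
  obtain ⟨y, rfl⟩ := hG.exists_eq_smul (b := b) hax fun r hr =>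
    hR.dvd_of_annihilator hnil fun s hs => by
      obtain ⟨t, rfl⟩ := (hb s).1 hs
      rw [mul_right_comm, hr, zero_mul]
  exact ⟨b, y, (hb b).2 dvd_rfl, rfl⟩

variable (hR : IsChainRing R) (hnil : ∀ a ∈ maximalIdeal R, IsNilpotent a)
include hR hnil

lemma IsAlmostFPInjective.flat_of_annihilator
    (h : ∀ (x : G) (a : R), x ≠ 0 → a ≠ 0 → a ∈ maximalIdeal R →
      ¬ ∀ r : R, r • x = 0 ↔ a ∣ r) : Module.Flat R G := by
  rw [hR.flat_iff]
  intro a x hax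
  by_cases hx : x = 0
  · exact ⟨0, 0, by simp, by simp [hx]⟩
  by_cases ha : a = 0
  · exact ⟨1, x, by simp [ha], by simp⟩
  have haP : a ∈ maximalIdeal R := by
    rw [mem_maximalIdeal]
    exact fun hu => hx ((hu.smul_eq_zero).1 hax)
  obtain ⟨c, hcx, hac⟩ : ∃ c : R, c • x = 0 ∧ ¬ a ∣ c := by
    by_contra! hne
    refine h x a hx ha haP fun r => ⟨hne r, ?_⟩
    rintro ⟨t, rfl⟩
    rw [mul_comm, mul_smul, hax, smul_zero]
  obtain ⟨b, hab, hbc⟩ : ∃ b : R, a * b = 0 ∧ b * c ≠ 0 := by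
    by_contra! hne
    exact hac (hR.dvd_of_annihilator hnil hne)
  obtain ⟨y, rfl⟩ := hG.exists_eq_smul (b := b) hcx fun r hr =>
    (hR.dvd_or_dvd c r).resolve_right fun ⟨t, ht⟩ =>
      hbc (by rw [ht, ← mul_assoc, hr, zero_mul])
  exact ⟨b, y, hab, rfl⟩

omit hG
variable (hcoh : ¬ IsCoherentRing R)
include hcoh

/-- An element with principal annihilator `Ra` is never a multiple by an element killed by `a`. -/
lemma ne_smul_of_annihilator_eq {a b : R} {x y : G} (hx : x ≠ 0) (ha : a ≠ 0)
    (h : ∀ r : R, r • x = 0 ↔ a ∣ r) (hab : a * b = 0) :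
    x ≠ b • y := by
  rintro rfl
  refine not_annihilator_principal hR hnil hcoh (a := b) (d := a) ?_ ?_ fun r => ⟨fun hr => ?_, ?_⟩
  · rintro rfl
    exact hx (zero_smul _ _)
  · rw [mem_maximalIdeal]
    exact fun hu => ha (hu.mul_left_eq_zero.1 hab)
  · exact (h r).1 (by rw [← mul_smul, mul_comm, hr, zero_smul])
  · rintro ⟨t, rfl⟩
    linear_combination t * hab

lemma not_annihilator_eq_of_flat [Module.Flat R G] {a : R} {x : G} (hx : x ≠ 0) (ha : a ≠ 0) :
    ¬ ∀ r : R, r • x = 0 ↔ a ∣ r := by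
  intro h
  obtain ⟨b, y, hab, hxy⟩ := hR.flat_iff.1 (inferInstanceAs (Module.Flat R G)) a x
    ((h a).2 dvd_rfl)
  exact ne_smul_of_annihilator_eq hR hnil hcoh hx ha h hab hxy

lemma flat_maximalIdeal : Module.Flat R (maximalIdeal R) := by
  rw [hR.flat_iff]
  rintro a ⟨x, hx⟩ hax
  replace hax : a * x = 0 := congrArg Subtype.val hax
  by_cases ha : a = 0
  · exact ⟨1, ⟨x, hx⟩, by simp [ha], by simp⟩
  by_cases haP : a ∈ maximalIdeal R
  · obtain ⟨b, p, hp, hb, rfl⟩ := hR.exists_annihilator_factor hnil hcoh ha haP hax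
    exact ⟨b, ⟨p, hp⟩, hb, rfl⟩
  · have hu : IsUnit a := by simpa using haP
    exact ⟨0, 0, by simp, Subtype.ext (by simpa using hu.mul_right_eq_zero.1 hax)⟩

/-- Modules killed by the maximal ideal have weak dimension at most two. -/
lemma torVanishes_of_smul_eq_zero {V : Type u} [AddCommGroup V] [Module R V]
    (hV : ∀ p ∈ maximalIdeal R, ∀ v : V, p • v = 0) (n : ℕ) : TorVanishes R (n + 2) V := by
  let q : (V →₀ R) →ₗ[R] V := Finsupp.linearCombination R id
  have hq : Function.Surjective q := Finsupp.linearCombination_id_surjective R V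
  have hflat : Module.Flat R (LinearMap.ker q) := by
    refine (hR.flat_iff (M := LinearMap.ker q)).2 ?_
    rintro a ⟨f, hf⟩ haf
    replace haf : a • f = 0 := congrArg Subtype.val haf
    by_cases ha : a = 0
    · exact ⟨1, ⟨f, hf⟩, by simp [ha], by simp⟩
    by_cases haP : a ∈ maximalIdeal R
    · obtain ⟨b, g, hab, rfl⟩ := hR.flat_iff.1 (inferInstanceAs (Module.Flat R (V →₀ R))) a f haf
      obtain ⟨c, p, hp, hac, rfl⟩ := hR.exists_annihilator_factor hnil hcoh ha haP hab
      refine ⟨c, ⟨p • g, ?_⟩, hac, Subtype.ext (mul_smul c p g)⟩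
      rw [LinearMap.mem_ker, map_smul, hV p hp]
    · have hu : IsUnit a := by simpa using haP
      exact ⟨0, 0, by simp, Subtype.ext (by simpa using hu.smul_eq_zero.1 haf)⟩
  exact TorVanishes.of_exact_right (Submodule.injective_subtype _) hq
    (LinearMap.exact_subtype_ker_map q) (TorVanishes.of_flat _) (TorVanishes.of_flat _)

/-- Every element of `P ⊗ G` is a pure tensor. -/
lemma exists_eq_tmul_maximalIdeal (t : maximalIdeal R ⊗[R] G) :
    ∃ (p : maximalIdeal R) (g : G), t = p ⊗ₜ[R] g := by
  induction t using TensorProduct.induction_on with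
  | zero => exact ⟨0, 0, by simp⟩
  | tmul p g => exact ⟨p, g, rfl⟩
  | add s t hs ht =>
    obtain ⟨⟨p, hp⟩, g, rfl⟩ := hs
    obtain ⟨⟨p', hp'⟩, g', rfl⟩ := ht
    obtain ⟨p₁, h₁, q, -, q', -, rfl, rfl⟩ :=
      exists_common_mul_of_mem_maximalIdeal hR hnil hcoh hp hp'
    have key : ∀ (r : R) (h : p₁ * r ∈ maximalIdeal R) (z : G),
        (⟨p₁ * r, h⟩ : maximalIdeal R) ⊗ₜ[R] z = (⟨p₁, h₁⟩ : maximalIdeal R) ⊗ₜ[R] (r • z) := by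
      intro r h z
      rw [← TensorProduct.smul_tmul]
      congr 1
      exact Subtype.ext (mul_comm p₁ r)
    exact ⟨⟨p₁, h₁⟩, q • g + q' • g', by rw [key, key, TensorProduct.tmul_add]⟩

include hG

lemma IsAlmostFPInjective.flat_maximalIdeal_tensor :
    Module.Flat R (maximalIdeal R ⊗[R] G) := by
  have hPflat := flat_maximalIdeal hR hnil hcoh
  rw [hR.flat_iff]
  intro a t hat
  obtain ⟨⟨p, hp⟩, g, rfl⟩ := exists_eq_tmul_maximalIdeal hR hnil hcoh t
  by_cases ha : a = 0
  · exact ⟨1, _, by simp [ha], (one_smul _ _).symm⟩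
  by_cases haP : a ∉ maximalIdeal R
  · have hu : IsUnit a := by simpa using haP
    exact ⟨0, 0, by simp, by simpa using hu.smul_eq_zero.1 hat⟩
  rw [not_not] at haP
  by_cases hap : a * p = 0
  · obtain ⟨b, q, hq, hab, rfl⟩ := hR.exists_annihilator_factor hnil hcoh ha haP hap
    exact ⟨b, (⟨q, hq⟩ : maximalIdeal R) ⊗ₜ[R] g, hab, rfl⟩
  obtain ⟨s, hsg, ⟨p', hp'⟩, hs⟩ : ∃ s : R, s • g = 0 ∧ ∃ y : maximalIdeal R,
      a • (⟨p, hp⟩ : maximalIdeal R) = s • y := by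
    refine hR.exists_of_tmul_eq_zero
      (Module.Flat.rTensor_preserves_injective_linearMap _ (Submodule.injective_subtype _)) ?_
    have := congrArg (TensorProduct.comm R (maximalIdeal R) G) hat
    rwa [TensorProduct.smul_tmul', TensorProduct.comm_tmul, map_zero] at this
  replace hs : a * p = s * p' := congrArg Subtype.val hs
  obtain ⟨p₁, h₁, p₂, h₂, q, hq, rfl, rfl⟩ :=
    exists_common_mul_of_mem_maximalIdeal hR hnil hcoh hp hp'
  have hpg : (⟨p₁ * p₂, hp⟩ : maximalIdeal R) ⊗ₜ[R] g =
      (⟨p₁, h₁⟩ : maximalIdeal R) ⊗ₜ[R] (p₂ • g) := by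
    rw [← TensorProduct.smul_tmul]
    congr 1
    exact Subtype.ext (mul_comm p₁ p₂)
  by_cases hsp : s ∣ p₂
  · obtain ⟨w, rfl⟩ := hsp
    exact ⟨0, 0, by simp, by
      rw [hpg, mul_comm, mul_smul, hsg, smul_zero, TensorProduct.tmul_zero, smul_zero]⟩
  obtain ⟨r, -, rfl⟩ := hR.exists_mem_maximalIdeal_of_not_dvd hsp
  have har : ¬ a ∣ r := by
    rintro ⟨t, rfl⟩
    exact hap (eq_zero_of_eq_mul_mem_maximalIdeal (Ideal.mul_mem_left _ t hq)
      (by linear_combination hs))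
  obtain ⟨b, hab, hbr⟩ : ∃ b : R, a * b = 0 ∧ b * r ≠ 0 := by
    by_contra! hne
    exact har (hR.dvd_of_annihilator hnil hne)
  obtain ⟨y, hy⟩ := hG.exists_eq_smul (b := b) (c := r) (x := p₂ • g)
    (by rw [← mul_smul, mul_comm, hsg]) fun z hz =>
      (hR.dvd_or_dvd r z).resolve_right fun ⟨t, ht⟩ =>
        hbr (by rw [ht, ← mul_assoc, hz, zero_mul])
  exact ⟨b, (⟨p₁, h₁⟩ : maximalIdeal R) ⊗ₜ[R] y, hab, by rw [hpg, hy, TensorProduct.tmul_smul]⟩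

lemma IsAlmostFPInjective.torVanishes_three : TorVanishes R 3 G := by
  have hflat := hG.flat_maximalIdeal_tensor hR hnil hcoh
  let μ : maximalIdeal R ⊗[R] G →ₗ[R] G :=
    TensorProduct.lift ((LinearMap.lsmul R G).comp (maximalIdeal R).subtype)
  have hμ : ∀ (p : maximalIdeal R) (g : G), μ (p ⊗ₜ[R] g) = (p : R) • g := fun p g => rfl
  have hker : TorVanishes R 2 (LinearMap.ker μ) := by
    refine torVanishes_of_smul_eq_zero hR hnil hcoh ?_ 0
    rintro p hp ⟨t, ht⟩
    obtain ⟨q, g, rfl⟩ := exists_eq_tmul_maximalIdeal hR hnil hcoh t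
    refine Subtype.ext ?_
    have hqg : (q : R) • g = 0 := ht
    have hpq : p • q = (q : R) • (⟨p, hp⟩ : maximalIdeal R) := Subtype.ext (mul_comm p (q : R))
    change p • q ⊗ₜ[R] g = 0
    rw [TensorProduct.smul_tmul', hpq, TensorProduct.smul_tmul, hqg, TensorProduct.tmul_zero]
  have hrange : TorVanishes R 3 (LinearMap.range μ) :=
    TorVanishes.of_exact_right (Submodule.injective_subtype _) μ.surjective_rangeRestrict
      (by
        intro x
        rw [← LinearMap.mem_ker, LinearMap.ker_rangeRestrict]
        exact LinearMap.exact_subtype_ker_map μ x)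
      (TorVanishes.of_flat _) hker
  have hquot : TorVanishes R 3 (G ⧸ LinearMap.range μ) := by
    refine torVanishes_of_smul_eq_zero hR hnil hcoh ?_ 1
    intro p hp v
    obtain ⟨g, rfl⟩ := Submodule.mkQ_surjective _ v
    rw [← map_smul, Submodule.mkQ_apply, Submodule.Quotient.mk_eq_zero]
    exact ⟨(⟨p, hp⟩ : maximalIdeal R) ⊗ₜ[R] g, rfl⟩
  exact TorVanishes.of_exact_middle (Submodule.injective_subtype _) (Submodule.mkQ_surjective _)
    (LinearMap.exact_subtype_mkQ _) hrange hquot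

lemma IsAlmostFPInjective.flat_of_torVanishes_two (h₂ : TorVanishes R 2 G) :
    Module.Flat R G := by
  let F := G →₀ R
  let π : F →ₗ[R] G := Finsupp.linearCombination R id
  have hπ : Function.Surjective π := Finsupp.linearCombination_id_surjective R G
  have hK : TorVanishes R 1 (LinearMap.ker π) :=
    TorVanishes.of_exact_left (Submodule.injective_subtype _) hπ
      (LinearMap.exact_subtype_ker_map π) h₂ (TorVanishes.of_flat _)
  have hKflat := hR.flat_of_torVanishes_one hK
  refine hG.flat_of_annihilator hR hnil fun x a hx ha haP h => ?_
  obtain ⟨f, rfl⟩ := hπ x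
  obtain ⟨c, hc, hac⟩ := exists_ne_zero_mul_eq_zero_of_isNilpotent (hnil a haP)
  obtain ⟨b, ⟨k, hk⟩, hcb, hafk⟩ := (hR.flat_iff (M := LinearMap.ker π)).1 hKflat c
    ⟨a • f, by rw [LinearMap.mem_ker, map_smul]; exact (h a).2 dvd_rfl⟩
    (Subtype.ext (by
      change c • a • f = 0
      rw [← mul_smul, mul_comm, hac, zero_smul]))
  replace hafk : a • f = b • k := congrArg Subtype.val hafk
  replace hk : π k = 0 := hk
  have hflat := (hR.flat_iff (M := F)).1 inferInstance
  rcases hR.dvd_or_dvd a b with ⟨d, rfl⟩ | ⟨d, rfl⟩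
  · obtain ⟨b', g, hab', hg⟩ := hflat a (f - d • k) (by rw [smul_sub, hafk, mul_smul, sub_self])
    refine ne_smul_of_annihilator_eq hR hnil hcoh (y := π g) hx ha h hab' ?_
    rw [← map_smul, ← hg, map_sub, map_smul, hk, smul_zero, sub_zero]
  · obtain ⟨b', g, hbb', hg⟩ := hflat b (d • f - k) (by
      rw [smul_sub, ← hafk, mul_smul, sub_self])
    have hb : b ≠ 0 := left_ne_zero_of_mul ha
    have hdx : ∀ r : R, r • π (d • f) = 0 ↔ b ∣ r := by
      intro r
      rw [map_smul, ← mul_smul, h]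
      constructor
      · rintro ⟨w, hw⟩
        refine (dvd_sub_left (dvd_mul_right b w)).1
          ((hR.dvd_or_dvd b (r - b * w)).resolve_right fun ⟨z, hz⟩ => ha ?_)
        linear_combination d * hz + z * hw
      · rintro ⟨w, rfl⟩
        exact ⟨w, by ring⟩
    refine ne_smul_of_annihilator_eq hR hnil hcoh (x := π (d • f)) (y := π g) ?_ hb hdx hbb' ?_
    · intro h0
      obtain ⟨w, hw⟩ := (hdx 1).1 (by rw [h0, smul_zero])
      refine hc ?_
      linear_combination c * hw + w * hcb
    · rw [← map_smul, ← hg, map_sub, hk, sub_zero]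

omit hG hR hnil hcoh

omit [IsLocalRing R] in
/-- Over a valuation domain every module has weak dimension at most one. -/
lemma IsChainRing.torVanishes_two_of_isDomain (hR : IsChainRing R) [IsDomain R] (G : Type u)
    [AddCommGroup G] [Module R G] : TorVanishes R 2 G := by
  let q : (G →₀ R) →ₗ[R] G := Finsupp.linearCombination R id
  have hq : Function.Surjective q := Finsupp.linearCombination_id_surjective R G
  have hflat : Module.Flat R (LinearMap.ker q) := by
    refine (hR.flat_iff (M := LinearMap.ker q)).2 fun a x hax => ?_
    rcases smul_eq_zero.1 hax with rfl | rfl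
    · exact ⟨1, x, by simp, by simp⟩
    · exact ⟨0, 0, by simp, by simp⟩
  exact TorVanishes.of_exact_right (Submodule.injective_subtype _) hq
    (LinearMap.exact_subtype_ker_map q) (TorVanishes.of_flat _) (TorVanishes.of_flat _)

end ArchimedeanChainRing

/-- Let `R` be an Archimedean chain ring with maximal ideal `P` and `G`
an almost FP-injective module. Then `w.d.(G) ≤ 2`; moreover (1) `w.d.(G) = 0` if `R` is an
IF-ring; (2) `w.d.(G) ≤ 1` if `R` is a (valuation) domain; (3) if `R` is not coherent then
`w.d.(G) = 2` or `w.d.(G) = 0`, and `G` is flat iff for every `0 ≠ x ∈ G` the annihilator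
`(0 : x)` is not of the form `Ra` for some `0 ≠ a ∈ P`; furthermore `P ⊗_R G` is flat and
almost FP-injective. -/
theorem weakDim_of_almostFPInjective_archimedean (R : Type u) [CommRing R] [IsLocalRing R]
    (hR : IsChainRing R)
    (harch : ∀ I : Ideal R, I.IsPrime → I ≠ ⊥ → I = IsLocalRing.maximalIdeal R)
    (G : Type u) [AddCommGroup G] [Module R G] (hG : IsAlmostFPInjective R G) :
    weakDim R G ≤ 2 ∧
    (IsIFRing R → weakDim R G = 0) ∧
    (IsDomain R → weakDim R G ≤ 1) ∧
    (¬ IsCoherentRing R →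
      (weakDim R G = 2 ∨ weakDim R G = 0) ∧
      (Module.Flat R G ↔ ∀ x : G, x ≠ 0 →
        ¬ ∃ a : R, a ≠ 0 ∧ a ∈ IsLocalRing.maximalIdeal R ∧
          Ideal.torsionOf R G x = Ideal.span {a}) ∧
      Module.Flat R (TensorProduct R (IsLocalRing.maximalIdeal R) G) ∧
      IsAlmostFPInjective R (TensorProduct R (IsLocalRing.maximalIdeal R) G)) := by
  have hnil (hD : ¬ IsDomain R) : ∀ a ∈ IsLocalRing.maximalIdeal R, IsNilpotent a :=
    fun a ha => isNilpotent_of_mem_maximalIdeal harch hD ha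
  have hdom (hD : IsDomain R) : weakDim R G ≤ 1 :=
    weakDim_le_of_torVanishes (hR.torVanishes_two_of_isDomain G)
  have hle : weakDim R G ≤ 2 := by
    by_cases hD : IsDomain R
    · exact (hdom hD).trans (by norm_num)
    by_cases hcoh : IsCoherentRing R
    · have := hG.flat_of_isCoherentRing hR (hnil hD) hcoh
      exact weakDim_eq_zero_of_flat.trans_le zero_le
    · exact weakDim_le_of_torVanishes (hG.torVanishes_three hR (hnil hD) hcoh)
  refine ⟨hle, fun hIF => ?_, hdom, fun hcoh => ?_⟩
  · have := hG.flat_of_isIFRing hR hIF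
    exact weakDim_eq_zero_of_flat
  have hnil' := hnil fun _ => hcoh hR.isCoherentRing_of_isDomain
  have htors (x : G) (a : R) : Ideal.torsionOf R G x = Ideal.span {a} ↔
      ∀ r : R, r • x = 0 ↔ a ∣ r := by
    simp_rw [Ideal.ext_iff, Ideal.mem_torsionOf_iff, Ideal.mem_span_singleton]
  have htensor := hG.flat_maximalIdeal_tensor hR hnil' hcoh
  refine ⟨?_, ⟨?_, fun h => ?_⟩, htensor, ?_⟩
  · by_cases hflat : Module.Flat R G
    · exact Or.inr weakDim_eq_zero_of_flat
    · exact Or.inl (hle.antisymm (two_le_weakDim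
        (fun h => hflat (hR.flat_of_torVanishes_one h))
        fun h => hflat (hG.flat_of_torVanishes_two hR hnil' hcoh h)))
  · rintro hflat x hx ⟨a, ha, -, hxa⟩
    exact not_annihilator_eq_of_flat hR hnil' hcoh hx ha ((htors x a).1 hxa)
  · exact hG.flat_of_annihilator hR hnil' fun x a hx ha haP hxa =>
      h x hx ⟨a, ha, haP, (htors x a).2 hxa⟩
  · exact hR.isAlmostFPInjective_of_flat (fun _ _ h => hR.dvd_of_annihilator hnil' h) _
end

section
/- Let R be a local fqp-ring which is not a chain ring. Then every nonzero almost FP-injective R-module G has infinite weak dimension: w.d.(G) = ∞. -/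
open CategoryTheory

universe u

/-- `V` is `M`-projective: the natural map `Hom_R(V, M) → Hom_R(V, M/X)` is surjective
for every submodule `X` of `M`. -/
def IsMProjective (R : Type u) [CommRing R] (V M : Type u) [AddCommGroup V] [Module R V]
    [AddCommGroup M] [Module R M] : Prop :=
  ∀ X : Submodule R M, Function.Surjective fun f : V →ₗ[R] M => X.mkQ ∘ₗ f

/-- `V` is quasi-projective: `V` is `V`-projective. -/
def IsQuasiProjective (R : Type u) [CommRing R] (V : Type u) [AddCommGroup V]
    [Module R V] : Prop :=
  IsMProjective R V V

/-- An fqp-ring: every finitely generated ideal is quasi-projective. -/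
def IsFqpRing (R : Type u) [CommRing R] : Prop :=
  ∀ I : Ideal R, I.FG → IsQuasiProjective R I


theorem exists_linearMap_of_span_pair {R M W : Type*} [CommRing R] [AddCommGroup M] [Module R M]
    [AddCommGroup W] [Module R W] {a b : M} (hspan : ∀ x : M, ∃ p q : R, x = p • a + q • b)
    {α β : W} (h : ∀ p q : R, p • a + q • b = 0 → p • α + q • β = 0) :
    ∃ g : M →ₗ[R] W, g a = α ∧ g b = β := by
  let L : R × R →ₗ[R] M :=
    (LinearMap.toSpanSingleton R M a).coprod (LinearMap.toSpanSingleton R M b)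
  let T : R × R →ₗ[R] W :=
    (LinearMap.toSpanSingleton R W α).coprod (LinearMap.toSpanSingleton R W β)
  have hL : Function.Surjective L := fun x => by
    obtain ⟨p, q, rfl⟩ := hspan x
    exact ⟨(p, q), by simp [L]⟩
  let g := (LinearMap.ker L).liftQ T (fun x hx => h x.1 x.2 (by simpa [L] using hx)) ∘ₗ
    (L.quotKerEquivOfSurjective hL).symm.toLinearMap
  have hg : ∀ x, g (L x) = T x := fun x => by
    have : (L.quotKerEquivOfSurjective hL).symm (L x) = Submodule.Quotient.mk x :=
      (LinearEquiv.symm_apply_eq _).2 rfl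
    simp only [g, LinearMap.comp_apply, LinearEquiv.coe_coe, this]
    rfl
  exact ⟨g, by simpa [L, T] using hg (1, 0), by simpa [L, T] using hg (0, 1)⟩

theorem inter_eq_zero_and_ann_le_of_isQuasiProjective_span_pair {R : Type u} [CommRing R]
    [IsLocalRing R] {a b : R} (hq : IsQuasiProjective R (Ideal.span {a, b}))
    (hab : ¬ a ∣ b) (hba : ¬ b ∣ a) :
    (∀ x, a ∣ x → b ∣ x → x = 0) ∧ ∀ u, u * a = 0 → u * b = 0 := by
  let I : Ideal R := Ideal.span {a, b}
  let a' : I := ⟨a, Ideal.subset_span (by simp)⟩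
  let b' : I := ⟨b, Ideal.subset_span (by simp)⟩
  have hadd : ∀ {w : R}, ¬ IsUnit w → IsUnit (1 + w) := fun {w} hw => by
    by_contra h
    have := IsLocalRing.nonunits_add h (b := -w) (by simpa using hw)
    simp at this
  have hspan : ∀ x : I, ∃ p q : R, x = p • a' + q • b' := by
    rintro ⟨x, hx⟩
    obtain ⟨p, q, rfl⟩ := Ideal.mem_span_pair.1 hx
    exact ⟨p, q, Subtype.ext (by simp [a', b'])⟩
  have lift : ∀ (X : Submodule R I) (α β : I),
      (∀ p q : R, p • a' + q • b' = 0 → p • α + q • β ∈ X) →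
      ∃ f : I →ₗ[R] I, f a' - α ∈ X ∧ f b' - β ∈ X := by
    intro X α β h
    obtain ⟨g, hga, hgb⟩ := exists_linearMap_of_span_pair (W := I ⧸ X) (α := X.mkQ α)
      (β := X.mkQ β) hspan (fun p q hpq => by
        rw [← map_smul, ← map_smul, ← map_add]
        exact (Submodule.Quotient.mk_eq_zero X).2 (h p q hpq))
    obtain ⟨f, rfl⟩ := hq X g
    exact ⟨f, (Submodule.Quotient.eq X).1 hga, (Submodule.Quotient.eq X).1 hgb⟩
  have unit_dvd : ∀ {u v x y : R}, IsUnit u → u * x = v * y → y ∣ x := by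
    rintro _ v x y ⟨u, rfl⟩ h
    exact ⟨↑u⁻¹ * v, by rw [mul_comm y, mul_assoc, ← h, ← mul_assoc, Units.inv_mul, one_mul]⟩
  have inter : ∀ x, a ∣ x → b ∣ x → x = 0 := by
    let X : Submodule R I := Submodule.span R {a'} ⊓ Submodule.span R {b'}
    have hX : ∀ x ∈ X, ∃ p q : R, (x : R) = p * a ∧ (x : R) = q * b := by
      rintro x ⟨hx, hx'⟩
      obtain ⟨p, rfl⟩ := Submodule.mem_span_singleton.1 hx
      obtain ⟨q, hq⟩ := Submodule.mem_span_singleton.1 hx'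
      exact ⟨p, q, rfl, congrArg Subtype.val hq.symm⟩
    obtain ⟨f, h1, h2⟩ := lift X a' 0 (fun p q hpq => by
      refine ⟨Submodule.mem_span_singleton.2 ⟨p, by simp⟩,
        Submodule.mem_span_singleton.2 ⟨-q, ?_⟩⟩
      rw [smul_zero, add_zero, neg_smul, neg_eq_iff_add_eq_zero, add_comm, hpq])
    obtain ⟨p, s, hp, hs⟩ := hX _ h1
    obtain ⟨q', q, hq', hq⟩ := hX _ h2
    rintro x ⟨u, hu⟩ ⟨v, hv⟩
    have hux : u • a' = v • b' := Subtype.ext (by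
      change u * a = v * b
      rw [mul_comm u, mul_comm v, ← hu, ← hv])
    have hf := congrArg (fun z : I => (z : R)) (congrArg f hux)
    simp only [map_smul, Submodule.coe_smul, smul_eq_mul] at hf
    simp only [Submodule.coe_sub, sub_zero] at hp hs hq hq'
    change (f a' : R) - a = _ at hp
    change (f a' : R) - a = _ at hs
    have hpu : ¬ IsUnit p := fun h => hba (unit_dvd h (hp.symm.trans hs))
    have hqu : ¬ IsUnit q := fun h => hab (unit_dvd h (hq.symm.trans hq'))
    have hpq : ¬ IsUnit (p + -q) := IsLocalRing.nonunits_add hpu (by simpa using hqu)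
    exact (hadd hpq).mul_right_eq_zero.1 (by
      linear_combination hf - u * hp + v * hq + (1 + p) * hu - q * hv)
  refine ⟨inter, fun u hu => ?_⟩
  have hdir : ∀ p q : R, p • a' + q • b' = 0 → p * a = 0 ∧ q * b = 0 := fun p q hpq => by
    have h : p * a + q * b = 0 := congrArg Subtype.val hpq
    have h0 := inter (p * a) ⟨p, mul_comm _ _⟩ ⟨-q, by linear_combination h⟩
    exact ⟨h0, by rw [← h, h0, zero_add]⟩
  let A : Ideal R := LinearMap.ker (LinearMap.toSpanSingleton R R a)
  have hA : ∀ x, x ∈ A ↔ x * a = 0 := fun x => by simp [A]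
  obtain ⟨f, h1, -⟩ :=
    lift (Submodule.map (LinearMap.toSpanSingleton R I b') A) b' 0 (fun p q hpq =>
      ⟨p, (hA p).2 (hdir p q hpq).1, by simp⟩)
  obtain ⟨w, hw, hfw⟩ := h1
  have hw' : ¬ IsUnit w := fun h => hab (by
    have : a = 0 := by simpa [h.mul_right_eq_zero] using (hA w).1 hw
    exact absurd (this ▸ dvd_zero b) hba)
  have hua : u • a' = 0 := Subtype.ext hu
  have hfu : u • f a' = 0 := by rw [← map_smul, hua, map_zero]
  have e1 : w * b = (f a' : R) - b := congrArg Subtype.val hfw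
  have e2 : u * (f a' : R) = 0 := congrArg Subtype.val hfu
  have e3 : (1 + w) * (u * b) = 0 := by linear_combination u * e1 + e2
  exact (hadd hw').mul_right_eq_zero.1 e3

/-- A local fqp-ring which is not a chain ring has a prime ideal `N` with `N ^ 2 = 0`, divisible by
the elements outside `N`, that contains two elements `t`, `r` annihilated only by `N` and generating
independent cyclic ideals. -/
theorem IsFqpRing.exists_isPrime_of_not_isChainRing {R : Type u} [CommRing R] [IsLocalRing R]
    (hfqp : IsFqpRing R) (hnc : ¬ IsChainRing R) :
    ∃ (N : Ideal R) (t r : R), N.IsPrime ∧ t ∈ N ∧ r ∈ N ∧ (∀ n ∈ N, ∀ m ∈ N, n * m = 0) ∧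
      (∀ d ∉ N, ∀ n ∈ N, ∃ n' ∈ N, n = d * n') ∧ (∀ a, a * r = 0 → a ∈ N) ∧
      ∀ a b, t * a = r * b → a ∈ N := by
  have hkey : ∀ a b : R, ¬ a ∣ b → ¬ b ∣ a →
      (∀ x, a ∣ x → b ∣ x → x = 0) ∧ ∀ u, u * a = 0 → u * b = 0 := fun a b =>
    inter_eq_zero_and_ann_le_of_isQuasiProjective_span_pair
      (hfqp _ (Submodule.fg_span (Set.toFinite _)))
  have hsq : ∀ a b : R, ¬ a ∣ b → ¬ b ∣ a → a * b = 0 ∧ a * a = 0 := fun a b h1 h2 => by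
    have h0 := (hkey a b h1 h2).1 (a * b) ⟨b, rfl⟩ ⟨a, mul_comm _ _⟩
    exact ⟨h0, (hkey b a h2 h1).2 a h0⟩
  obtain ⟨t, r, htr, hrt⟩ : ∃ t r : R, ¬ t ∣ r ∧ ¬ r ∣ t := by
    simp only [IsChainRing, not_forall, not_or, SetLike.not_le_iff_exists] at hnc
    obtain ⟨I, J, ⟨x, hxI, hxJ⟩, ⟨y, hyJ, hyI⟩⟩ := hnc
    exact ⟨x, y, fun h => hyI (I.mem_of_dvd h hxI), fun h => hxJ (J.mem_of_dvd h hyJ)⟩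
  have hr0 : r ≠ 0 := fun h => htr (h ▸ dvd_zero t)
  have hdis := (hkey t r htr hrt).1
  have hann_tr := (hkey t r htr hrt).2
  have hann_rt := (hkey r t hrt htr).2
  let N : Ideal R := LinearMap.ker (LinearMap.toSpanSingleton R R r)
  have hN : ∀ x, x ∈ N ↔ x * r = 0 := fun x => by simp [N]
  have hNt : ∀ x ∈ N, x * t = 0 := fun x hx => hann_rt x ((hN x).1 hx)
  have hprime : ∀ x y, x * y ∈ N → x ∈ N ∨ y ∈ N := by
    intro x y hxy
    by_cases hy : y ∈ N
    · exact .inr hy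
    left
    have hyr : y * r ≠ 0 := fun h => hy ((hN y).2 h)
    rw [hN] at hxy ⊢
    have h1 : ¬ t ∣ y * r := fun h => hyr (hdis _ h ⟨y, mul_comm _ _⟩)
    have h2 : ¬ y * r ∣ t := fun h => hrt ((Dvd.intro_left y rfl).trans h)
    exact hann_tr x ((hkey (y * r) t h2 h1).2 x (by rw [← mul_assoc, hxy]))
  have hannN : ∀ n, n ∈ N → (∀ s, (s = r ∨ s = t) → ¬ n ∣ s → ∀ m ∈ N, n * m = 0) := by
    intro n hn s hs hns m hm
    have hms : m * s = 0 := by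
      rcases hs with rfl | rfl
      · exact (hN m).1 hm
      · exact hNt m hm
    by_cases hsn : s ∣ n
    · obtain ⟨c, rfl⟩ := hsn
      linear_combination c * hms
    · rw [mul_comm]
      exact (hkey s n hsn hns).2 m hms
  have hsqN : ∀ n ∈ N, ∀ m ∈ N, n * m = 0 := by
    intro n hn
    by_cases h1 : n ∣ r
    swap
    · exact hannN n hn r (.inl rfl) h1
    by_cases h2 : n ∣ t
    swap
    · exact hannN n hn t (.inr rfl) h2
    exfalso
    obtain ⟨c, hc⟩ := h1
    obtain ⟨d, hd⟩ := h2
    have hcd : ¬ c ∣ d := fun h => hrt (hc ▸ hd ▸ mul_dvd_mul_left n h)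
    have hdc : ¬ d ∣ c := fun h => htr (hc ▸ hd ▸ mul_dvd_mul_left n h)
    have hcc := (hsq c d hcd hdc).2
    have hnt := hNt n hn
    by_cases h3 : t ∣ c
    · obtain ⟨h, rfl⟩ := h3
      exact hr0 (by rw [hc]; linear_combination h * hnt)
    by_cases h4 : c ∣ t
    swap
    · exact hr0 (by rw [hc]; exact (hkey t c h3 h4).2 n hnt)
    obtain ⟨h, hh⟩ := h4
    have hnh : ¬ n ∣ h := by
      rintro ⟨g, rfl⟩
      exact hrt ⟨g, by rw [hh, hc]; ring⟩
    have hhn : ¬ h ∣ n := by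
      rintro ⟨g, rfl⟩
      exact htr ⟨g, by rw [hh, hc]; ring⟩
    have hnn := (hsq n h hnh hhn).2
    by_cases h5 : c ∣ n
    · obtain ⟨g, rfl⟩ := h5
      exact hr0 (by rw [hc]; linear_combination g * hcc)
    by_cases h6 : n ∣ c
    · obtain ⟨g, rfl⟩ := h6
      exact hr0 (by rw [hc]; linear_combination g * hnn)
    · exact hr0 (by rw [hc]; exact (hsq n c h6 h5).1)
  have htt : t ∈ N := (hN t).2 (hsq t r htr hrt).1
  refine ⟨N, t, r, ⟨fun h => hr0 ?_, fun {x y} => hprime x y⟩, htt, ?_, hsqN, ?_, fun a => (hN a).2,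
    ?_⟩
  · simpa using (hN 1).1 (h ▸ Submodule.mem_top)
  · exact (hN r).2 (hsq r t hrt htr).2
  · intro d hd n hn
    have hnd : ¬ n ∣ d := fun h => hd (N.mem_of_dvd h hn)
    by_cases hdn : d ∣ n
    · obtain ⟨c, rfl⟩ := hdn
      exact ⟨c, (hprime d c hn).resolve_left hd, rfl⟩
    · have := (hsq d n hdn hnd).2
      exact absurd ((hprime d d (this ▸ N.zero_mem)).elim id id) hd
  · intro a b h
    rw [hN]
    apply hann_tr
    have := hdis (t * a) ⟨a, rfl⟩ ⟨b, h⟩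
    rw [mul_comm, this]

theorem exists_comp_eq_of_isZero_ext_one {R : Type u} [CommRing R] {F E : ModuleCat.{u} R}
    (P : ProjectiveResolution F)
    (h : Limits.IsZero (((Ext R (ModuleCat.{u} R) 1).obj (Opposite.op F)).obj E))
    (f : P.complex.X 1 ⟶ E) (hf : P.complex.d 2 1 ≫ f = 0) :
    ∃ g : P.complex.X 0 ⟶ E, P.complex.d 1 0 ≫ g = f := by
  have h1 := h.of_iso (P.isoExt (R := R) 1 E).symm
  rw [← HomologicalComplex.exactAt_iff_isZero_homology,
    HomologicalComplex.exactAt_iff' _ 0 1 2 (by simp) (by simp),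
    ShortComplex.moduleCat_exact_iff] at h1
  exact h1 f hf

theorem tor_exact {R : Type u} [CommRing R] (G : Type u) [AddCommGroup G] [Module R G]
    {M : ModuleCat.{u} R} (P : ProjectiveResolution M) (k : ℕ)
    (h : Limits.IsZero (((Tor (ModuleCat.{u} R) (k + 1)).obj (ModuleCat.of R G)).obj M)) :
    Function.Exact ((P.complex.d (k + 2) (k + 1)).hom.lTensor G)
      ((P.complex.d (k + 1) k).hom.lTensor G) := by
  have h1 := h.of_iso (P.isoLeftDerivedObj
    ((MonoidalCategory.tensoringLeft (ModuleCat.{u} R)).obj (ModuleCat.of R G)) (k + 1)).symm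
  have h2 := (HomologicalComplex.exactAt_iff_isZero_homology _ _).2 h1
  rw [HomologicalComplex.exactAt_iff' _ (k + 2) (k + 1) k (by simp) (by simp)] at h2
  exact (ShortComplex.ShortExact.moduleCat_exact_iff_function_exact _).1 h2

theorem IsFPInjective.exists_smul_eq {R : Type u} [CommRing R] {E : Type u} [AddCommGroup E]
    [Module R E] (hE : IsFPInjective R E) {r : R} {e : E} (h : ∀ a, a * r = 0 → a • e = 0) :
    ∃ y : E, e = r • y := by
  have hfp : Module.FinitePresentation R (R ⧸ Ideal.span {r}) :=
    Module.finitePresentation_of_surjective (Submodule.mkQ _) (Submodule.mkQ_surjective _)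
      (by rw [Submodule.ker_mkQ]; exact Submodule.fg_span_singleton r)
  let F := ModuleCat.of R (R ⧸ Ideal.span {r})
  let P := projectiveResolution F
  let π : P.complex.X 0 →ₗ[R] R ⧸ Ideal.span {r} := (P.π.f 0).hom
  let d₁ : P.complex.X 1 →ₗ[R] P.complex.X 0 := (P.complex.d 1 0).hom
  let d₂ : P.complex.X 2 →ₗ[R] P.complex.X 1 := (P.complex.d 2 1).hom
  have hd : ∀ x, d₁ (d₂ x) = 0 := fun x =>
    congrArg (fun f => f.hom x) (P.complex.d_comp_d 2 1 0)
  have hex : Function.Exact d₁ π :=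
    (ShortComplex.ShortExact.moduleCat_exact_iff_function_exact _).1 P.exact₀
  have hπ : Function.Surjective π := (ModuleCat.epi_iff_surjective (P.π.f 0)).1 inferInstance
  have hproj : ∀ i, Module.Projective R (P.complex.X i) := fun i =>
    (IsProjective.iff_projective _).2 (P.projective i)
  obtain ⟨l, hl⟩ := Module.projective_lifting_property (Submodule.mkQ (Ideal.span {r})) π
    (Submodule.mkQ_surjective _)
  have hl' : ∀ x, Ideal.Quotient.mk (Ideal.span {r}) (l x) = π x := fun x =>
    LinearMap.congr_fun hl x
  let mulr : R →ₗ[R] Ideal.span {r} := LinearMap.toSpanSingleton R _ ⟨r, Ideal.subset_span rfl⟩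
  have hmulr : Function.Surjective mulr := by
    rintro ⟨x, hx⟩
    obtain ⟨c, rfl⟩ := Ideal.mem_span_singleton'.1 hx
    exact ⟨c, rfl⟩
  obtain ⟨μ, hμ⟩ := Module.projective_lifting_property mulr
    ((l ∘ₗ d₁).codRestrict (Ideal.span {r}) fun x => by
      rw [LinearMap.comp_apply, ← Ideal.Quotient.eq_zero_iff_mem, hl']
      exact hex.apply_apply_eq_zero x) hmulr
  have hμ' : ∀ x, μ x * r = l (d₁ x) := fun x => congrArg Subtype.val (LinearMap.congr_fun hμ x)
  obtain ⟨g, hg⟩ := exists_comp_eq_of_isZero_ext_one P (hE F hfp)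
    (ModuleCat.ofHom (LinearMap.toSpanSingleton R E e ∘ₗ μ)) (by
      ext x
      exact h _ ((hμ' (d₂ x)).trans (by rw [hd, map_zero])))
  have hg' : ∀ x, g.hom (d₁ x) = μ x • e := fun x => congrArg (fun f => f.hom x) hg
  obtain ⟨p, hp⟩ := hπ 1
  obtain ⟨c, hc⟩ : ∃ c, c * r = l p - 1 := Ideal.mem_span_singleton'.1 (by
    rw [← Ideal.Quotient.eq_zero_iff_mem, map_sub, hl', hp, map_one, sub_self])
  obtain ⟨q, hq⟩ := (hex (r • p)).1 (by
    rw [map_smul, hp, Algebra.smul_def, mul_one]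
    exact Ideal.Quotient.eq_zero_iff_mem.2 (Ideal.subset_span rfl))
  have h1 := h (μ q - 1 - c * r) (by
    have := hμ' q
    rw [hq, map_smul, smul_eq_mul] at this
    linear_combination this - r * hc)
  have h2 := hg' q
  rw [hq, map_smul] at h2
  refine ⟨g.hom p - c • e, ?_⟩
  rw [smul_sub, h2, smul_smul, mul_comm r c]
  rw [sub_smul, sub_smul, one_smul] at h1
  rw [eq_comm, ← sub_eq_zero, ← h1]
  abel

theorem mem_smul_top_iff_tmul_one_eq_zero {R M : Type*} [CommRing R] [AddCommGroup M] [Module R M]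
    (I : Ideal R) (x : M) :
    x ∈ I • (⊤ : Submodule R M) ↔ TensorProduct.tmul R x (1 : R ⧸ I) = 0 := by
  rw [← (TensorProduct.tensorQuotEquivQuotSMul M I).map_eq_zero_iff,
    ← map_one (Ideal.Quotient.mk I),
    TensorProduct.tensorQuotEquivQuotSMul_tmul_mk, one_smul, Submodule.Quotient.mk_eq_zero]

theorem IsPureSubmodule.exists_smul_eq {R : Type u} [CommRing R] {E : Type u} [AddCommGroup E]
    [Module R E] {D : Submodule R E} (hD : IsPureSubmodule D) {d : R} {x : E} (h : d • x ∈ D) :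
    ∃ y ∈ D, d • x = d • y := by
  have h1 : (⟨d • x, h⟩ : D) ∈ Ideal.span {d} • (⊤ : Submodule R D) := by
    rw [mem_smul_top_iff_tmul_one_eq_zero]
    apply hD (R ⧸ Ideal.span {d})
    rw [LinearMap.rTensor_tmul, map_zero]
    exact (mem_smul_top_iff_tmul_one_eq_zero _ _).1
      (Submodule.smul_mem_smul (Ideal.subset_span rfl) trivial)
  rw [Submodule.ideal_span_singleton_smul] at h1
  obtain ⟨y, -, hy⟩ := h1
  exact ⟨y, y.2, congrArg Subtype.val hy.symm⟩

theorem rTensor_lTensor_apply {R X Y Z W : Type*} [CommRing R]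
    [AddCommGroup X] [Module R X] [AddCommGroup Y] [Module R Y]
    [AddCommGroup Z] [Module R Z] [AddCommGroup W] [Module R W]
    (u : X →ₗ[R] Y) (v : Z →ₗ[R] W) (t : TensorProduct R X Z) :
    u.rTensor W (v.lTensor X t) = v.lTensor Y (u.rTensor Z t) := by
  rw [← LinearMap.comp_apply, ← LinearMap.comp_apply, LinearMap.rTensor_comp_lTensor,
    LinearMap.lTensor_comp_rTensor]

/-- The diagram chase behind dimension shifting along `0 → K → F → G → 0`: if
`G ⊗ A → G ⊗ B → G ⊗ C` is exact, then an element of `K ⊗ C` is a boundary as soon as its image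
in `F ⊗ C` is. -/
theorem mem_range_lTensor_of_exact {R K F G A B C : Type*} [CommRing R]
    [AddCommGroup K] [Module R K] [AddCommGroup F] [Module R F] [AddCommGroup G] [Module R G]
    [AddCommGroup A] [Module R A] [AddCommGroup B] [Module R B] [AddCommGroup C] [Module R C]
    {i : K →ₗ[R] F} {p : F →ₗ[R] G} (hip : Function.Exact i p) (hi : Function.Injective i)
    (hp : Function.Surjective p) [Module.Flat R C]
    {a : A →ₗ[R] B} {b : B →ₗ[R] C} (hab : b ∘ₗ a = 0)
    (hG : Function.Exact (a.lTensor G) (b.lTensor G)) {x : TensorProduct R K C}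
    (hx : i.rTensor C x ∈ LinearMap.range (b.lTensor F)) :
    x ∈ LinearMap.range (b.lTensor K) := by
  obtain ⟨f, hf⟩ := hx
  obtain ⟨g, hg⟩ := (hG (p.rTensor B f)).1 (by
    rw [← rTensor_lTensor_apply, hf]
    exact (rTensor_exact C hip hp).apply_apply_eq_zero x)
  obtain ⟨f₂, rfl⟩ := LinearMap.rTensor_surjective A hp g
  obtain ⟨x', hx'⟩ := ((rTensor_exact B hip hp) (f - a.lTensor F f₂)).1 (by
    rw [map_sub, rTensor_lTensor_apply, hg, sub_self])
  refine ⟨x', Module.Flat.rTensor_preserves_injective_linearMap i hi ?_⟩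
  rw [rTensor_lTensor_apply, hx', map_sub, hf, ← LinearMap.comp_apply, ← LinearMap.lTensor_comp,
    hab, LinearMap.lTensor_zero, LinearMap.zero_apply, sub_zero]

theorem mem_smul_top_of_exact {R K F G A B C : Type*} [CommRing R]
    [AddCommGroup K] [Module R K] [AddCommGroup F] [Module R F] [AddCommGroup G] [Module R G]
    [AddCommGroup A] [Module R A] [AddCommGroup B] [Module R B] [AddCommGroup C] [Module R C]
    {i : K →ₗ[R] F} {p : F →ₗ[R] G} (hip : Function.Exact i p) (hi : Function.Injective i)
    (hp : Function.Surjective p) [Module.Flat R C]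
    {a : A →ₗ[R] B} {b : B →ₗ[R] C} (hab : b ∘ₗ a = 0)
    (hG : Function.Exact (a.lTensor G) (b.lTensor G)) {I : Ideal R} {π : C →ₗ[R] R ⧸ I}
    (hex : Function.Exact b π) (hπ : Function.Surjective π) {x : K}
    (hx : i x ∈ I • (⊤ : Submodule R F)) : x ∈ I • (⊤ : Submodule R K) := by
  obtain ⟨c, hc⟩ := hπ 1
  rw [mem_smul_top_iff_tmul_one_eq_zero, ← hc, ← LinearMap.lTensor_tmul] at hx ⊢
  exact (lTensor_exact K hex hπ _).2 (mem_range_lTensor_of_exact hip hi hp hab hG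
    ((lTensor_exact F hex hπ _).1 hx))

theorem lTensor_exact_of_exact {R K F G A B C C' : Type*} [CommRing R]
    [AddCommGroup K] [Module R K] [AddCommGroup F] [Module R F] [AddCommGroup G] [Module R G]
    [AddCommGroup A] [Module R A] [AddCommGroup B] [Module R B] [AddCommGroup C] [Module R C]
    [AddCommGroup C'] [Module R C']
    {i : K →ₗ[R] F} {p : F →ₗ[R] G} (hip : Function.Exact i p) (hi : Function.Injective i)
    (hp : Function.Surjective p) [Module.Flat R C] [Module.Flat R F]
    {a : A →ₗ[R] B} {b : B →ₗ[R] C} {c : C →ₗ[R] C'} (hab : b ∘ₗ a = 0)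
    (hG : Function.Exact (a.lTensor G) (b.lTensor G)) (hbc : Function.Exact b c) :
    Function.Exact (b.lTensor K) (c.lTensor K) := by
  refine fun x => ⟨fun hx => mem_range_lTensor_of_exact hip hi hp hab hG
    ((Module.Flat.lTensor_exact F hbc _).1 ?_), ?_⟩
  · rw [← rTensor_lTensor_apply, hx, map_zero]
  · rintro ⟨z, rfl⟩
    rw [← LinearMap.comp_apply, ← LinearMap.lTensor_comp, hbc.linearMap_comp_eq_zero,
      LinearMap.lTensor_zero, LinearMap.zero_apply]

theorem exists_mul_sub_sum_mem {R ι : Type*} [CommRing R] {N : Ideal R} (hN : N.IsPrime) {t r : R}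
    (htr : ∀ a b, t * a = r * b → a ∈ N) (n : ι → R)
    (hn : ∀ i, ∀ m ∈ N, n i * m = 0) (s : Finset ι) :
    ∃ d ∉ N, ∃ q : ι → R, ∀ (a b : R) (c : ι → R), t * a = r * b + ∑ i ∈ s, n i * c i →
      d * a - ∑ i ∈ s, q i * c i ∈ N := by
  classical
  induction s using Finset.induction_on with
  | empty =>
    exact ⟨1, hN.one_notMem, 0, fun a b c h => by simpa using htr a b (by simpa using h)⟩
  | insert j s hj ih =>
    obtain ⟨d, hd, q, hq⟩ := ih
    by_cases hrel : ∃ e ∉ N, ∃ (a₀ b₀ : R) (c₀ : ι → R),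
        t * a₀ = r * b₀ + ∑ i ∈ s, n i * c₀ i + n j * e
    · obtain ⟨e, he, a₀, b₀, c₀, h₀⟩ := hrel
      refine ⟨d * e, fun h => (hN.mem_or_mem h).elim hd he,
        Function.update (fun i => e * q i) j (d * a₀ - ∑ i ∈ s, q i * c₀ i), fun a b c h => ?_⟩
      rw [Finset.sum_insert hj] at h
      have := hq (e * a - c j * a₀) (e * b - c j * b₀) (fun i => e * c i - c j * c₀ i) (by
        simp only [mul_sub, Finset.sum_sub_distrib, mul_left_comm _ e, mul_left_comm _ (c j),
          ← Finset.mul_sum]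
        linear_combination e * h - c j * h₀)
      simp only [mul_sub, Finset.sum_sub_distrib, mul_left_comm _ e, mul_left_comm _ (c j),
          ← Finset.mul_sum] at this
      have hsum :
          ∑ i ∈ s, Function.update (fun i => e * q i) j (d * a₀ - ∑ i ∈ s, q i * c₀ i) i * c i =
          e * ∑ i ∈ s, q i * c i := by
        rw [Finset.mul_sum]
        refine Finset.sum_congr rfl fun i hi => ?_
        rw [Function.update_of_ne (ne_of_mem_of_not_mem hi hj), mul_assoc]
      rw [Finset.sum_insert hj, Function.update_self, hsum]
      convert this using 1
      ring
    · push Not at hrel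
      refine ⟨d, hd, Function.update q j 0, fun a b c h => ?_⟩
      rw [Finset.sum_insert hj] at h
      have hcj : c j ∈ N := by
        by_contra hc
        exact hrel (c j) hc a b c (by linear_combination h)
      have hsum : ∑ i ∈ s, Function.update q j 0 i * c i = ∑ i ∈ s, q i * c i :=
        Finset.sum_congr rfl fun i hi => by
          rw [Function.update_of_ne (ne_of_mem_of_not_mem hi hj)]
      rw [Finset.sum_insert hj, Function.update_self, hsum, zero_mul, zero_add]
      exact hq a b c (by rw [h, hn j _ hcj, zero_add])

/-- Every relation `t • y = r • z` in `M` is trivial modulo `N`: some multiple of `y` by an element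
outside `N` lies in `N • M`. -/
def HasTrivialRelationsModulo {R : Type*} [CommRing R] (N : Ideal R) (t r : R) (M : Type*)
    [AddCommGroup M] [Module R M] : Prop :=
  ∀ y z : M, t • y = r • z → ∃ d ∉ N, d • y ∈ N • (⊤ : Submodule R M)

theorem HasTrivialRelationsModulo.of_ker {R F G : Type*} [CommRing R] {N : Ideal R}
    (hN : N.IsPrime) (hsq : ∀ n ∈ N, ∀ m ∈ N, n * m = 0) {t r : R} (ht : t ∈ N) (hr : r ∈ N)
    (htr : ∀ a b, t * a = r * b → a ∈ N) [AddCommGroup F] [Module R F] [Module.Flat R F]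
    [AddCommGroup G] [Module R G] {p : F →ₗ[R] G} (hp : Function.Surjective p)
    (h : ∀ x ∈ N • (⊤ : Submodule R F), p x = 0 → ∃ d ∉ N, d • x ∈ N • LinearMap.ker p) :
    HasTrivialRelationsModulo N t r G := by
  intro y z hyz
  obtain ⟨y, rfl⟩ := hp y
  obtain ⟨z, rfl⟩ := hp z
  obtain ⟨e, he, hx⟩ := h (t • y - r • z)
    (sub_mem (Submodule.smul_mem_smul ht trivial) (Submodule.smul_mem_smul hr trivial))
    (by rw [map_sub, map_smul, map_smul, hyz, sub_self])
  rw [← Submodule.span_eq (LinearMap.ker p), ← Set.image_id (LinearMap.ker p : Set F),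
    Submodule.mem_ideal_smul_span_iff_exists_sum'] at hx
  obtain ⟨n, hnN, hn⟩ := hx
  obtain ⟨d, hd, q, hq⟩ := exists_mul_sub_sum_mem hN htr (fun i : n.support => n i)
    (fun i m hm => hsq _ (hnN i) m hm) Finset.univ
  obtain ⟨l, a, w, ha, hw⟩ := Module.Flat.isTrivialRelation_of_sum_smul_eq_zero
    (ι := Option (Option n.support))
    (f := fun o => o.elim t fun o => o.elim (-r) fun i => - n i)
    (x := fun o => o.elim (e • y) fun o => o.elim (e • z) fun i => (i.1 : F)) (by
      simp only [Fintype.sum_option, Option.elim, neg_smul, Finset.sum_neg_distrib]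
      rw [Finset.sum_coe_sort n.support fun i => n i • (i : F), ← add_assoc,
        ← sub_eq_add_neg, ← sub_eq_add_neg, sub_eq_zero, smul_comm t, smul_comm r, ← smul_sub]
      exact hn.symm)
  have hy := ha none
  have hk := fun i => ha (some (some i))
  simp only [Option.elim] at hy hk
  refine ⟨d * e, fun h => (hN.mem_or_mem h).elim hd he, ?_⟩
  have key : (d * e) • y - ∑ i, q i • (i.1 : F) ∈ N • (⊤ : Submodule R F) := by
    rw [mul_smul, hy]
    simp only [hk, Finset.smul_sum, smul_smul]
    rw [Finset.sum_comm, ← Finset.sum_sub_distrib]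
    refine sum_mem fun j _ => ?_
    rw [← Finset.sum_smul, ← sub_smul]
    refine Submodule.smul_mem_smul
      (hq _ (a (some none) j) (fun i => a (some (some i)) j) ?_) trivial
    have := hw j
    simp only [Fintype.sum_option, Option.elim, neg_mul, Finset.sum_neg_distrib] at this
    linear_combination this
  have := Submodule.mem_map_of_mem (f := p) key
  rw [Submodule.map_smul'', map_sub, map_sum, map_smul] at this
  rw [Finset.sum_eq_zero (fun i _ => by rw [map_smul, LinearMap.mem_ker.1 i.1.2, smul_zero]),
    sub_zero] at this
  exact Submodule.smul_mono le_rfl le_top this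

theorem hasTrivialRelationsModulo_of_exact {R : Type u} [CommRing R] {N : Ideal R}
    (hN : N.IsPrime) (hsq : ∀ n ∈ N, ∀ m ∈ N, n * m = 0) {t r : R} (ht : t ∈ N) (hr : r ∈ N)
    (htr : ∀ a b, t * a = r * b → a ∈ N) (k : ℕ) (G : Type u) [AddCommGroup G] [Module R G]
    (h : ∀ (M : ModuleCat.{u} R) (P : ProjectiveResolution M),
      Function.Exact ((P.complex.d (k + 2) (k + 1)).hom.lTensor G)
        ((P.complex.d (k + 1) k).hom.lTensor G)) :
    HasTrivialRelationsModulo N t r G := by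
  have hproj : ∀ {M : ModuleCat.{u} R} (P : ProjectiveResolution M) i,
      Module.Projective R (P.complex.X i) := fun P i =>
    (IsProjective.iff_projective _).2 (P.projective i)
  have hd : ∀ {M : ModuleCat.{u} R} (P : ProjectiveResolution M) i,
      (P.complex.d (i + 1) i).hom ∘ₗ (P.complex.d (i + 2) (i + 1)).hom = 0 := fun P i =>
    congrArg ModuleCat.Hom.hom (P.complex.d_comp_d (i + 2) (i + 1) i)
  obtain ⟨F, _, _, _, p, hp⟩ : ∃ (F : Type u) (_ : AddCommGroup F) (_ : Module R F)
      (_ : Module.Flat R F) (p : F →ₗ[R] G), Function.Surjective p :=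
    ⟨G →₀ R, _, _, inferInstance, _, Finsupp.linearCombination_id_surjective R G⟩
  obtain ⟨K, _, _, i, hi, hip⟩ : ∃ (K : Type u) (_ : AddCommGroup K) (_ : Module R K)
      (i : K →ₗ[R] F), Function.Injective i ∧ Function.Exact i p :=
    ⟨LinearMap.ker p, _, _, _, Submodule.injective_subtype _, LinearMap.exact_subtype_ker_map p⟩
  have hmap : (N • (⊤ : Submodule R K)).map i = N • LinearMap.ker p := by
    rw [Submodule.map_smul'', Submodule.map_top, hip.linearMap_ker_eq]
  refine .of_ker hN hsq ht hr htr hp fun x hxN hx => ?_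
  obtain ⟨x, rfl⟩ := (hip x).1 hx
  suffices ∃ d ∉ N, d • x ∈ N • (⊤ : Submodule R K) by
    obtain ⟨d, hd, hdx⟩ := this
    refine ⟨d, hd, ?_⟩
    rw [← hmap, ← map_smul]
    exact Submodule.mem_map_of_mem hdx
  cases k with
  | zero =>
    let P := projectiveResolution (ModuleCat.of R (R ⧸ N))
    let π : P.complex.X 0 →ₗ[R] R ⧸ N := (P.π.f 0).hom
    have hex : Function.Exact (P.complex.d 1 0).hom π :=
      (ShortComplex.ShortExact.moduleCat_exact_iff_function_exact _).1 P.exact₀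
    have hπ : Function.Surjective π := (ModuleCat.epi_iff_surjective (P.π.f 0)).1 inferInstance
    refine ⟨1, hN.one_notMem, ?_⟩
    rw [one_smul]
    exact mem_smul_top_of_exact hip hi hp (hd P 0) (h _ P) hex hπ hxN
  | succ k =>
    refine hasTrivialRelationsModulo_of_exact hN hsq ht hr htr k K (fun M P =>
      lTensor_exact_of_exact hip hi hp (hd P (k + 1)) (h M P)
        ((ShortComplex.ShortExact.moduleCat_exact_iff_function_exact _).1 (P.exact_succ k)))
      x 0 (hi ?_)
    have hNN : N * N = ⊥ := by
      rw [eq_bot_iff, Ideal.mul_le]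
      exact fun n hn m hm => (Submodule.mem_bot R).2 (hsq n hn m hm)
    have htx := Submodule.smul_mem_smul ht hxN
    rw [← mul_smul, hNN, Submodule.bot_smul, Submodule.mem_bot] at htx
    rw [map_smul, htx, smul_zero, map_zero]

/-- Over a local fqp-ring `R` which is not a chain ring, every nonzero
almost FP-injective module has infinite weak dimension. -/
theorem weakDim_eq_top_of_almostFPInjective_fqp (R : Type u) [CommRing R] [IsLocalRing R]
    (hfqp : IsFqpRing R) (hnc : ¬ IsChainRing R)
    (G : Type u) [AddCommGroup G] [Module R G] [Nontrivial G]
    (hG : IsAlmostFPInjective R G) :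
    weakDim R G = ⊤ := by
  obtain ⟨N, t, r, hN, ht, hr, hsq, hdiv, hann, htr⟩ :=
    hfqp.exists_isPrime_of_not_isChainRing hnc
  obtain ⟨E, _, _, D, hE, hD, ⟨e⟩⟩ := hG
  refine sInf_eq_top.2 ?_
  rintro _ ⟨k, -, hk⟩
  exfalso
  have hrel := hasTrivialRelationsModulo_of_exact hN hsq ht hr htr k G
    fun M P => tor_exact G P k (hk M)
  let ρ : E →ₗ[R] G := e.toLinearMap ∘ₗ D.mkQ
  have hρ : Function.Surjective ρ := e.surjective.comp D.mkQ_surjective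
  have hker : ∀ x, ρ x = 0 ↔ x ∈ D := fun x => by simp [ρ]
  have hNN : N * N = ⊥ := by
    rw [eq_bot_iff, Ideal.mul_le]
    exact fun n hn m hm => (Submodule.mem_bot R).2 (hsq n hn m hm)
  have hNkill : ∀ d ∉ N, ∀ y : G, d • y ∈ N • (⊤ : Submodule R G) → ∀ n ∈ N, n • y = 0 := by
    intro d hd y hy n hn
    obtain ⟨n', hn', rfl⟩ := hdiv d hd n hn
    have := Submodule.smul_mem_smul hn' hy
    rwa [← mul_smul, hNN, Submodule.bot_smul, Submodule.mem_bot, smul_smul, mul_comm] at this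
  have hNtop : ∀ y : G, ∀ n ∈ N, n • y = 0 := by
    intro y
    obtain ⟨y', rfl⟩ := hρ y
    obtain ⟨z, hz⟩ := hE.exists_smul_eq (r := r) (e := t • y') fun a ha => by
      rw [smul_smul, hsq a (hann a ha) t ht, zero_smul]
    obtain ⟨d, hd, hdy⟩ := hrel (ρ y') (ρ z) (by rw [← map_smul, hz, map_smul])
    exact hNkill d hd _ hdy
  obtain ⟨x, hx⟩ := exists_ne (0 : G)
  obtain ⟨d, hd, hdx⟩ := hrel x 0 (by rw [hNtop x t ht, smul_zero])
  have hbot : N • (⊤ : Submodule R G) = ⊥ := by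
    rw [eq_bot_iff, Submodule.smul_le]
    exact fun n hn y _ => (Submodule.mem_bot R).2 (hNtop y n hn)
  rw [hbot, Submodule.mem_bot] at hdx
  obtain ⟨x, rfl⟩ := hρ x
  rw [← map_smul, hker] at hdx
  obtain ⟨w, hw, hdw⟩ := hD.exists_smul_eq hdx
  obtain ⟨y, hy⟩ := hE.exists_smul_eq (r := r) (e := x - w) fun a ha => by
    obtain ⟨n, -, rfl⟩ := hdiv d hd a (hann a ha)
    rw [mul_comm, mul_smul, smul_sub, hdw, sub_self, smul_zero]
  have hxy := map_sub ρ x w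
  rw [hy, map_smul, hNtop _ r hr, (hker w).2 hw, sub_zero] at hxy
  exact hx hxy.symm
end
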